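/- arXiv:2110.04723 — 3 statements merged into one kernel-verified Lean document; each statement's English description precedes it below -/
import Mathlib

section
/- With the standing setup, for each 1 ≤ i ≤ m the block [u,v]^{(i)} coincides with the Bruhat interval [u_i, v_i]; that is, {w ∈ [u,v] : w^{-1}(k) = a_i} = {w ∈ S_n : u_i ≤ w ≤ v_i}. -/
open Equiv Finset Polynomial

/-- The odd diagram of a permutation of `Fin n` (0-based positions and values):
boxes `(i, j)` with `w i > j`, `i < w⁻¹ j`, and `i`, `w⁻¹ j` of different parity. -/
def oddDiagram {n : ℕ} (w : Equiv.Perm (Fin n)) : Set (Fin n × Fin n) :=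
  {p | p.2 < w p.1 ∧ p.1 < w⁻¹ p.2 ∧ ((p.1 : ℕ) % 2 ≠ ((w⁻¹ p.2 : Fin n) : ℕ) % 2)}

/-- The Bruhat order on `S_n`: the reflexive-transitive closure of the relations
`x < x * (i j)` whenever `i < j` and `x i < x j`. -/
def bruhatLE {n : ℕ} : Equiv.Perm (Fin n) → Equiv.Perm (Fin n) → Prop :=
  Relation.ReflTransGen (fun x y => ∃ i j : Fin n, i < j ∧ x i < x j ∧ y = x * Equiv.swap i j)

/-- Strict Bruhat order. -/
def bruhatLT {n : ℕ} (x y : Equiv.Perm (Fin n)) : Prop := bruhatLE x y ∧ x ≠ y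

/-- The Coxeter length of a permutation, i.e. its number of inversions. -/
def invLength {n : ℕ} (w : Equiv.Perm (Fin n)) : ℕ :=
  (Finset.univ.filter (fun p : Fin n × Fin n => p.1 < p.2 ∧ w p.2 < w p.1)).card

namespace BruhatBlock

variable {n : ℕ}

theorem inv_apply_self (w : Perm (Fin n)) (l : Fin n) : w⁻¹ (w l) = l := w.symm_apply_apply l

theorem apply_inv_self (w : Perm (Fin n)) (q : Fin n) : w (w⁻¹ q) = q := w.apply_symm_apply q

/-- The number of positions up to `s` whose value is at most `q`. -/
def rk (w : Perm (Fin n)) (s q : Fin n) : ℕ :=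
  (univ.filter (fun l : Fin n => l ≤ s ∧ w l ≤ q)).card

/-- The rank-matrix comparison, which turns out to describe the Bruhat order. -/
def RankLE (x w : Perm (Fin n)) : Prop := ∀ s q, rk w s q ≤ rk x s q

/-- All values below `k` occupy the same positions in `x` and `w`. -/
def AgreeBelow (k : Fin n) (x w : Perm (Fin n)) : Prop := ∀ q, q < k → x⁻¹ q = w⁻¹ q

theorem AgreeBelow.symm {k : Fin n} {x w : Perm (Fin n)} (h : AgreeBelow k x w) :
    AgreeBelow k w x := fun q hq => (h q hq).symm

theorem AgreeBelow.trans {k : Fin n} {x y w : Perm (Fin n)} (h : AgreeBelow k x y)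
    (h' : AgreeBelow k y w) : AgreeBelow k x w := fun q hq => (h q hq).trans (h' q hq)

theorem AgreeBelow.apply_eq {k : Fin n} {x w : Perm (Fin n)} (h : AgreeBelow k x w) {l : Fin n}
    (hl : x l < k) : w l = x l := by
  have := h _ hl
  rw [inv_apply_self, Perm.eq_inv_iff_eq] at this
  exact this

theorem AgreeBelow.lt_iff {k : Fin n} {x w : Perm (Fin n)} (h : AgreeBelow k x w) {l : Fin n} :
    x l < k ↔ w l < k :=
  ⟨fun hl => (h.apply_eq hl).symm ▸ hl, fun hl => (h.symm.apply_eq hl).symm ▸ hl⟩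

theorem AgreeBelow.mul_swap {k : Fin n} {x : Perm (Fin n)} {i j : Fin n} (hi : k ≤ x i)
    (hj : k ≤ x j) : AgreeBelow k x (x * swap i j) := by
  intro q hq
  rw [Perm.eq_inv_iff_eq, Perm.mul_apply, swap_apply_of_ne_of_ne, apply_inv_self]
  · rintro rfl; rw [apply_inv_self] at hi; exact absurd hq (not_lt.2 hi)
  · rintro rfl; rw [apply_inv_self] at hj; exact absurd hq (not_lt.2 hj)

theorem RankLE.refl (x : Perm (Fin n)) : RankLE x x := fun _ _ => le_rfl

theorem RankLE.trans {x y z : Perm (Fin n)} (h : RankLE x y) (h' : RankLE y z) : RankLE x z :=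
  fun s q => (h' s q).trans (h s q)

theorem RankLE.mul_swap {x : Perm (Fin n)} {i j : Fin n} (hij : i < j) (hx : x i < x j) :
    RankLE x (x * swap i j) := by
  intro s q
  unfold rk
  by_cases hs : j ≤ s
  · refine Finset.card_le_card_of_injOn (swap i j) ?_ (swap i j).injective.injOn
    intro l hl
    rw [Finset.mem_coe, mem_filter] at hl ⊢
    simp only [mem_univ, true_and, Perm.mul_apply] at hl ⊢
    refine ⟨?_, hl.2⟩
    rcases eq_or_ne l i with rfl | h1
    · rwa [swap_apply_left]
    · rcases eq_or_ne l j with rfl | h2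
      · rw [swap_apply_right]; exact hij.le.trans hs
      · rw [swap_apply_of_ne_of_ne h1 h2]; exact hl.1
  · refine Finset.card_le_card ?_
    intro l hl
    simp only [mem_filter, mem_univ, true_and] at hl ⊢
    simp only [Perm.mul_apply] at hl ⊢
    refine ⟨hl.1, ?_⟩
    rcases eq_or_ne l i with rfl | h1
    · rw [swap_apply_left] at hl; exact hx.le.trans hl.2
    · rcases eq_or_ne l j with rfl | h2
      · exact absurd hl.1 hs
      · rw [swap_apply_of_ne_of_ne h1 h2] at hl; exact hl.2

theorem RankLE.of_bruhatLE {x y : Perm (Fin n)} (h : bruhatLE x y) : RankLE x y := by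
  induction h with
  | refl => exact RankLE.refl x
  | tail _ h ih =>
    obtain ⟨i, j, hij, hx, rfl⟩ := h
    exact ih.trans (RankLE.mul_swap hij hx)

/-- Moving up, the first value that changes position moves to the right. -/
theorem RankLE.inv_le {x w : Perm (Fin n)} {k : Fin n} (h : RankLE x w)
    (hag : AgreeBelow k x w) : x⁻¹ k ≤ w⁻¹ k := by
  by_contra! hlt
  refine absurd (h (w⁻¹ k) k) (not_le.2 ?_)
  refine Finset.card_lt_card ⟨?_, ?_⟩
  · intro l hl
    simp only [mem_filter, mem_univ, true_and] at hl ⊢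
    refine ⟨hl.1, ?_⟩
    rcases hl.2.lt_or_eq with h1 | h1
    · exact (hag.lt_iff.1 h1).le
    · rw [← h1, inv_apply_self] at hlt
      rw [← h1] at hl
      exact absurd hl.1 (not_le.2 hlt)
  · intro hsub
    have := @hsub (w⁻¹ k) (by simp)
    simp only [mem_filter, mem_univ, true_and] at this
    rcases this.2.lt_or_eq with h1 | h1
    · have := hag.apply_eq h1
      rw [apply_inv_self] at this
      exact absurd h1 (not_lt.2 this.le)
    · rw [← h1, inv_apply_self, h1] at hlt
      exact lt_irrefl _ hlt

theorem AgreeBelow.of_between {u w v : Perm (Fin n)} {k : Fin n} (huw : RankLE u w)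
    (hwv : RankLE w v) (h : AgreeBelow k u v) : AgreeBelow k u w := by
  intro q
  induction q using WellFoundedLT.induction with
  | ind q ih =>
    intro hq
    have h1 : AgreeBelow q u w := fun r hr => ih r hr (hr.trans hq)
    have h2 : AgreeBelow q u v := fun r hr => h r (hr.trans hq)
    refine le_antisymm (huw.inv_le h1) ?_
    rw [h q hq]
    exact hwv.inv_le (h1.symm.trans h2)

theorem RankLE.antisymm {x w : Perm (Fin n)} (h : RankLE x w) (h' : RankLE w x) : x = w := by
  apply inv_injective
  ext1 q
  have hag : AgreeBelow q x w := AgreeBelow.of_between h h' fun _ _ => rfl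
  exact le_antisymm (h.inv_le hag) (h'.inv_le hag.symm)

/-- Rank version of the greedy step: the first displaced value can be exchanged with the smallest
larger value in the window it has to cross. -/
theorem RankLE.step {x w : Perm (Fin n)} {k p p' : Fin n} (h : RankLE x w)
    (hag : AgreeBelow k x w) (hp : x p = k) (hpp : p < p') (hpc : p' ≤ w⁻¹ k)
    (hk : k < x p') (hmin : ∀ l, p < l → l ≤ w⁻¹ k → k < x l → x p' ≤ x l) :
    RankLE (x * swap p p') w := by
  intro s q
  by_cases hs : s < p ∨ p' ≤ s ∨ q < k ∨ x p' ≤ q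
  · refine (h s q).trans ?_
    unfold rk
    by_cases hs' : p' ≤ s
    · refine Finset.card_le_card_of_injOn (swap p p') ?_ (swap p p').injective.injOn
      intro l hl
      rw [Finset.mem_coe, mem_filter] at hl ⊢
      simp only [mem_univ, true_and, Perm.mul_apply, swap_apply_self] at hl ⊢
      refine ⟨?_, hl.2⟩
      rcases eq_or_ne l p with rfl | h1
      · rwa [swap_apply_left]
      · rcases eq_or_ne l p' with rfl | h2
        · rw [swap_apply_right]; exact hpp.le.trans hs'
        · rw [swap_apply_of_ne_of_ne h1 h2]; exact hl.1
    · refine Finset.card_le_card ?_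
      intro l hl
      simp only [mem_filter, mem_univ, true_and] at hl ⊢
      simp only [Perm.mul_apply] at hl ⊢
      refine ⟨hl.1, ?_⟩
      rcases eq_or_ne l p with rfl | h1
      · rw [swap_apply_left]
        rcases hs with hs | hs | hs | hs
        · exact absurd hl.1 (not_le.2 hs)
        · exact absurd hs hs'
        · rw [hp] at hl; exact absurd hl.2 (not_le.2 hs)
        · exact hs
      · rcases eq_or_ne l p' with rfl | h2
        · exact absurd hl.1 hs'
        · rw [swap_apply_of_ne_of_ne h1 h2]; exact hl.2
  · push Not at hs
    obtain ⟨hs1, hs2, hq1, hq2⟩ := hs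
    set c := w⁻¹ k with hc
    have hwc : w c = k := by rw [hc, apply_inv_self]
    set F := univ.filter (fun l : Fin n => s < l ∧ l ≤ c ∧ x l < k) with hF
    have h1 : rk w s q + F.card + 1 ≤ rk w c q := by
      unfold rk
      rw [← Finset.card_union_of_disjoint, ← Finset.card_insert_of_notMem (a := c)]
      · refine Finset.card_le_card ?_
        intro l hl
        simp only [hF, mem_insert, mem_union, mem_filter, mem_univ, true_and] at hl ⊢
        rcases hl with rfl | hl | hl
        · exact ⟨le_rfl, hwc ▸ hq1⟩
        · exact ⟨hl.1.trans (hs2.le.trans hpc), hl.2⟩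
        · exact ⟨hl.2.1, (hag.lt_iff.1 hl.2.2).le.trans hq1⟩
      · simp only [hF, mem_union, mem_filter, mem_univ, true_and, not_or, not_and]
        refine ⟨fun hcs => absurd hcs (not_le.2 (hs2.trans_le hpc)), fun _ _ hx => ?_⟩
        have := hag.lt_iff.1 hx
        rw [hwc] at this
        exact lt_irrefl _ this
      · rw [Finset.disjoint_left]
        intro l hl hl'
        simp only [hF, mem_filter, mem_univ, true_and] at hl hl'
        exact absurd hl.1 (not_le.2 hl'.1)
    have h2 : rk x c q ≤ rk (x * swap p p') s q + F.card + 1 := by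
      unfold rk
      refine le_trans (Finset.card_le_card ?_) ((Finset.card_insert_le p _).trans
        (Nat.succ_le_succ (Finset.card_union_le _ _)))
      intro l hl
      simp only [hF, mem_insert, mem_union, mem_filter, mem_univ, true_and] at hl ⊢
      simp only [Perm.mul_apply]
      by_cases hlp : l = p
      · exact Or.inl hlp
      right
      by_cases hls : l ≤ s
      · left
        rw [swap_apply_of_ne_of_ne hlp (hls.trans_lt hs2).ne]
        exact ⟨hls, hl.2⟩
      · right
        push Not at hls
        refine ⟨hls, hl.1, ?_⟩
        by_contra! hkl
        rcases hkl.lt_or_eq with h3 | h3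
        · exact absurd hl.2 (not_le.2 (hq2.trans_le (hmin l (hs1.trans_lt hls) hl.1 h3)))
        · rw [← hp] at h3
          exact hlp (x.injective h3.symm)
    have h3 := h c q
    omega

theorem bruhatLE_mul_swap {x : Perm (Fin n)} {i j : Fin n} (hij : i < j) (hx : x i < x j) :
    bruhatLE x (x * swap i j) :=
  Relation.ReflTransGen.single ⟨i, j, hij, hx, rfl⟩

theorem toLex_inv_lt_mul_swap {x : Perm (Fin n)} {i j : Fin n} (hij : i < j) (hx : x i < x j) :
    toLex (⇑x⁻¹) < toLex (⇑(x * swap i j)⁻¹) := by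
  refine ⟨x i, fun q hq => ?_, ?_⟩
  · exact AgreeBelow.mul_swap (le_refl (x i)) hx.le q hq
  · have : (x * swap i j)⁻¹ (x i) = j := by
      rw [Perm.inv_eq_iff_eq, Perm.mul_apply, swap_apply_right]
    change x⁻¹ (x i) < (x * swap i j)⁻¹ (x i)
    rw [this, inv_apply_self]
    exact hij

theorem RankLE.to_bruhat {x w : Perm (Fin n)} (h : RankLE x w) : bruhatLE x w := by
  have wf : WellFounded fun y z : Perm (Fin n) => toLex (⇑y⁻¹) > toLex (⇑z⁻¹) :=
    InvImage.wf (fun y : Perm (Fin n) => toLex (⇑y⁻¹)) (wellFounded_gt)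
  induction x using wf.induction with
  | _ x ih =>
    by_cases hxw : x = w
    · subst hxw; exact Relation.ReflTransGen.refl
    have hex : ∃ q, x⁻¹ q ≠ w⁻¹ q := by
      by_contra! hall
      exact hxw (inv_injective (Equiv.ext hall))
    obtain ⟨k, hk, hkmin⟩ := WellFounded.has_min (wellFounded_lt (α := Fin n))
      {q | x⁻¹ q ≠ w⁻¹ q} hex
    have hag : AgreeBelow k x w := fun q hq => by
      by_contra hne
      exact hkmin q hne hq
    have hlt : x⁻¹ k < w⁻¹ k := lt_of_le_of_ne (h.inv_le hag) hk
    have hne : (univ.filter (fun l => x⁻¹ k < l ∧ l ≤ w⁻¹ k ∧ k < x l)).Nonempty := by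
      refine ⟨w⁻¹ k, ?_⟩
      simp only [mem_filter, mem_univ, true_and, le_refl, hlt]
      by_contra! hle
      rcases hle.lt_or_eq with h1 | h1
      · have := hag.lt_iff.1 h1
        simp at this
      · rw [← h1, inv_apply_self, h1] at hlt
        exact lt_irrefl _ hlt
    obtain ⟨p', hp', hmin⟩ := Finset.exists_min_image _ (fun l => x l) hne
    simp only [mem_filter, mem_univ, true_and] at hp' hmin
    have hxp : x (x⁻¹ k) = k := apply_inv_self x k
    have hlt' : x (x⁻¹ k) < x p' := hxp.symm ▸ hp'.2.2
    exact (bruhatLE_mul_swap hp'.1 hlt').trans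
      (ih _ (toLex_inv_lt_mul_swap hp'.1 hlt') (h.step hag hxp hp'.1 hp'.2.1 hp'.2.2
        fun l h1 h2 h3 => hmin l ⟨h1, h2, h3⟩))

theorem bruhatLE_antisymm {x w : Perm (Fin n)} (h : bruhatLE x w) (h' : bruhatLE w x) : x = w :=
  (RankLE.of_bruhatLE h).antisymm (RankLE.of_bruhatLE h')

theorem bruhatLE_step {x w : Perm (Fin n)} {k p p' : Fin n} (h : bruhatLE x w)
    (hag : AgreeBelow k x w) (hp : x p = k) (hpp : p < p') (hpc : p' ≤ w⁻¹ k)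
    (hk : k < x p') (hmin : ∀ l, p < l → l ≤ w⁻¹ k → k < x l → x p' ≤ x l) :
    bruhatLE (x * swap p p') w :=
  ((RankLE.of_bruhatLE h).step hag hp hpp hpc hk hmin).to_bruhat

theorem bruhatLE_mul_revPerm {x y : Perm (Fin n)} (h : bruhatLE x y) :
    bruhatLE (y * Fin.revPerm) (x * Fin.revPerm) := by
  induction h with
  | refl => exact Relation.ReflTransGen.refl
  | tail _ h ih =>
    rename_i b c _
    obtain ⟨i, j, hij, hx, rfl⟩ := h
    refine Relation.ReflTransGen.head ⟨j.rev, i.rev, Fin.rev_lt_rev.2 hij, ?_, ?_⟩ ih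
    · simpa using hx
    · ext l
      simp only [Perm.mul_apply, Fin.revPerm_apply]
      rcases eq_or_ne l i.rev with rfl | h1
      · simp
      · rcases eq_or_ne l j.rev with rfl | h2
        · simp
        · rw [swap_apply_of_ne_of_ne h2 h1, swap_apply_of_ne_of_ne]
          · rintro rfl; simp at h1
          · rintro rfl; simp at h2

theorem revPerm_mul_self : (Fin.revPerm * Fin.revPerm : Perm (Fin n)) = 1 := by
  ext l; simp

/-- The mirror image of `bruhatLE_step`, lowering the upper permutation. -/
theorem bruhatLE_step_down {w y : Perm (Fin n)} {k p p' : Fin n} (h : bruhatLE w y)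
    (hag : AgreeBelow k w y) (hp : y p = k) (hpp : p' < p) (hpc : w⁻¹ k ≤ p')
    (hk : k < y p') (hmin : ∀ l, l < p → w⁻¹ k ≤ l → k < y l → y p' ≤ y l) :
    bruhatLE w (y * swap p' p) := by
  have hinv : ∀ (z : Perm (Fin n)) q, (z * Fin.revPerm : Perm (Fin n))⁻¹ q = (z⁻¹ q).rev := by
    intro z q
    rw [Perm.inv_eq_iff_eq]
    simp
  have h1 := bruhatLE_step (k := k) (p := p.rev) (p' := p'.rev) (bruhatLE_mul_revPerm h)
    (fun q hq => by rw [hinv, hinv, hag q hq]) (by simpa using hp) (Fin.rev_lt_rev.2 hpp)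
    (by rw [hinv]; exact Fin.rev_le_rev.2 hpc) (by simpa using hk)
    (fun l h2 h3 h4 => by
      rw [hinv] at h3
      simp only [Perm.mul_apply, Fin.revPerm_apply, Fin.rev_rev] at h4 ⊢
      exact hmin l.rev (Fin.rev_lt_iff.2 h2) (Fin.le_rev_iff.2 h3) h4)
  have h2 := bruhatLE_mul_revPerm h1
  rw [mul_assoc w, revPerm_mul_self, mul_one] at h2
  convert h2 using 1
  ext l
  simp only [Perm.mul_apply, Fin.revPerm_apply]
  rcases eq_or_ne l p with rfl | h3
  · simp
  · rcases eq_or_ne l p' with rfl | h4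
    · simp
    · rw [swap_apply_of_ne_of_ne h4 h3, swap_apply_of_ne_of_ne, Fin.rev_rev]
      · simpa using h3
      · simpa using h4

theorem mem_oddDiagram {w : Perm (Fin n)} {i l : Fin n} :
    (i, w l) ∈ oddDiagram w ↔ w l < w i ∧ i < l ∧ (i : ℕ) % 2 ≠ (l : ℕ) % 2 := by
  simp [oddDiagram]

/-- A same-parity exchange with no obstructing entry preserves the odd diagram. -/
theorem oddDiagram_mul_swap {x : Perm (Fin n)} {i j : Fin n} (hij : i < j) (hx : x i < x j)
    (hpar : (i : ℕ) % 2 = (j : ℕ) % 2)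
    (h1 : ∀ l, i < l → (l : ℕ) % 2 ≠ (i : ℕ) % 2 → x i < x l → ¬ x l < x j)
    (h2 : ∀ l, i < l → l < j → (l : ℕ) % 2 ≠ (i : ℕ) % 2 → ¬ x i < x l) :
    oddDiagram (x * swap i j) = oddDiagram x := by
  ext ⟨r, y⟩
  obtain ⟨l, rfl⟩ := x.surjective y
  rw [mem_oddDiagram]
  have hl : x l = (x * swap i j) (swap i j l) := by simp
  rw [hl, mem_oddDiagram, ← hl, Perm.mul_apply]
  have inj : ∀ s t : Fin n, x s = x t → s = t := fun s t h => x.injective h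
  rw [swap_apply_def, swap_apply_def]
  have hj := h1 l
  have h2l := h2 l
  have h2r := h2 r
  split_ifs <;> subst_vars <;> grind

theorem bruhatLE_parity_inv_eq {u v w : Perm (Fin n)} (huw : bruhatLE u w) (hwv : bruhatLE w v)
    (hD : ∀ z, bruhatLE u z → bruhatLE z v → oddDiagram z = oddDiagram u) (q : Fin n) :
    ((u⁻¹ q : Fin n) : ℕ) % 2 = ((w⁻¹ q : Fin n) : ℕ) % 2 := by
  induction huw with
  | refl => rfl
  | tail hb h ih =>
    rename_i b c
    obtain ⟨i, j, hij, hx, rfl⟩ := h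
    have hbc := bruhatLE_mul_swap hij hx
    rw [ih (hbc.trans hwv)]
    have hpar : (i : ℕ) % 2 = (j : ℕ) % 2 := by
      by_contra hne
      have h1 : (i, (b * swap i j) j) ∈ oddDiagram (b * swap i j) := by
        rw [mem_oddDiagram]
        simpa using ⟨hx, hij, hne⟩
      rw [hD _ (hb.trans hbc) hwv, ← hD _ hb (hbc.trans hwv), Perm.mul_apply, swap_apply_right,
        mem_oddDiagram] at h1
      exact lt_irrefl _ h1.1
    rw [mul_inv_rev, swap_inv, Perm.mul_apply, swap_apply_def]
    split_ifs with h1 h2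
    · rw [h1, hpar]
    · rw [h2, hpar]
    · rfl

/-- The odd diagram class of `u` is the Bruhat interval `[u, v]`, and `k` is the first value whose
positions in `u` and `v` differ. -/
structure IsClass (u v : Perm (Fin n)) (k : Fin n) : Prop where
  mem_iff : ∀ w, oddDiagram w = oddDiagram u ↔ bruhatLE u w ∧ bruhatLE w v
  agree : AgreeBelow k u v
  ne : u⁻¹ k ≠ v⁻¹ k

/-- The positions of the window between `u⁻¹ k` and `v⁻¹ k` with value at least `k` whose row of
the odd diagram has no box in a column beyond `k`. -/
def FreePos (u v : Perm (Fin n)) (k p : Fin n) : Prop :=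
  u⁻¹ k ≤ p ∧ p ≤ v⁻¹ k ∧ k ≤ u p ∧ ∀ y, k < y → (p, y) ∉ oddDiagram u

namespace IsClass

variable {u v : Perm (Fin n)} {k : Fin n}

theorem le (h : IsClass u v k) : bruhatLE u v := ((h.mem_iff u).1 rfl).2

theorem diag_eq (h : IsClass u v k) : oddDiagram v = oddDiagram u :=
  (h.mem_iff v).2 ⟨h.le, Relation.ReflTransGen.refl⟩

theorem inv_lt (h : IsClass u v k) : u⁻¹ k < v⁻¹ k :=
  lt_of_le_of_ne ((RankLE.of_bruhatLE h.le).inv_le h.agree) h.ne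

theorem parity (h : IsClass u v k) :
    ((u⁻¹ k : Fin n) : ℕ) % 2 = ((v⁻¹ k : Fin n) : ℕ) % 2 :=
  bruhatLE_parity_inv_eq h.le Relation.ReflTransGen.refl
    (fun z h1 h2 => (h.mem_iff z).2 ⟨h1, h2⟩) k

theorem le_iff (h : IsClass u v k) {p : Fin n} : k ≤ u p ↔ k ≤ v p := by
  rw [← not_lt, ← not_lt, h.agree.lt_iff]

/-- Entries of the other parity strictly inside the window are below `k`. -/
theorem lt_of_odd (h : IsClass u v k) {p : Fin n} (h1 : u⁻¹ k < p) (h2 : p < v⁻¹ k)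
    (hpar : (p : ℕ) % 2 ≠ ((u⁻¹ k : Fin n) : ℕ) % 2) : u p < k := by
  by_contra! hk
  have hvk : k ≤ v p := h.le_iff.1 hk
  have hne : k ≠ v p := by
    rintro heq
    rw [heq, inv_apply_self] at h2
    exact lt_irrefl _ h2
  have hmem : (p, v (v⁻¹ k)) ∈ oddDiagram v := by
    rw [mem_oddDiagram, apply_inv_self]
    exact ⟨lt_of_le_of_ne hvk hne, h2, by rwa [← h.parity]⟩
  rw [h.diag_eq, apply_inv_self, ← apply_inv_self u k, mem_oddDiagram] at hmem
  exact absurd h1 (not_lt.2 hmem.2.1.le)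

theorem parity_of_window (h : IsClass u v k) {p : Fin n} (h1 : u⁻¹ k ≤ p) (h2 : p ≤ v⁻¹ k)
    (hk : k ≤ u p) : (p : ℕ) % 2 = ((u⁻¹ k : Fin n) : ℕ) % 2 := by
  by_contra hpar
  rcases h1.eq_or_lt with rfl | h1
  · exact hpar rfl
  rcases h2.eq_or_lt with rfl | h2
  · exact hpar h.parity.symm
  exact absurd (h.lt_of_odd h1 h2 hpar) (not_lt.2 hk)

theorem gt_of_odd (h : IsClass u v k) {p : Fin n} (h1 : u⁻¹ k < p)
    (hpar : (p : ℕ) % 2 ≠ ((u⁻¹ k : Fin n) : ℕ) % 2) (hk : k ≤ u p) : v⁻¹ k < p := by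
  by_contra! h2
  exact hpar (h.parity_of_window h1.le h2 hk)

theorem freePos_parity (h : IsClass u v k) {p : Fin n} (hp : FreePos u v k p) :
    (p : ℕ) % 2 = ((u⁻¹ k : Fin n) : ℕ) % 2 :=
  h.parity_of_window hp.1 hp.2.1 hp.2.2.1

theorem freePos_left (h : IsClass u v k) : FreePos u v k (u⁻¹ k) := by
  refine ⟨le_rfl, h.inv_lt.le, (apply_inv_self u k).ge, fun y hy hmem => ?_⟩
  rw [← apply_inv_self u y, mem_oddDiagram, apply_inv_self, apply_inv_self] at hmem
  exact lt_asymm hy hmem.1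

theorem freePos_right (h : IsClass u v k) : FreePos u v k (v⁻¹ k) := by
  refine ⟨h.inv_lt.le, le_rfl, h.le_iff.2 (apply_inv_self v k).ge, fun y hy hmem => ?_⟩
  rw [← h.diag_eq, ← apply_inv_self v y, mem_oddDiagram, apply_inv_self, apply_inv_self] at hmem
  exact lt_asymm hy hmem.1

theorem increasing (h : IsClass u v k) {p q : Fin n} (hp : FreePos u v k p)
    (hq : FreePos u v k q) (hpq : p < q) : u p < u q := by
  by_contra! hle
  have hlt : u q < u p := lt_of_le_of_ne hle (u.injective.ne hpq.ne')
  set x := u * swap p q with hx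
  have hxp : x p = u q := by simp [hx]
  have hxq : x q = u p := by simp [hx]
  have hux : u = x * swap p q := by rw [hx, mul_assoc, swap_mul_self, mul_one]
  have hxu : bruhatLE x u := by
    rw [hux]; exact bruhatLE_mul_swap hpq (by rwa [hxp, hxq])
  have hoff : ∀ l : Fin n, (l : ℕ) % 2 ≠ (p : ℕ) % 2 → x l = u l := by
    intro l hl
    rw [hx, Perm.mul_apply, swap_apply_of_ne_of_ne]
    · rintro rfl; exact hl rfl
    · rintro rfl; exact hl ((h.freePos_parity hq).trans (h.freePos_parity hp).symm)
  have hdiag : oddDiagram u = oddDiagram x := by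
    conv_lhs => rw [hux]
    refine oddDiagram_mul_swap hpq (by rwa [hxp, hxq])
      ((h.freePos_parity hp).trans (h.freePos_parity hq).symm) ?_ ?_
    · intro l hl hpar h1 h2
      rw [hxp, hoff l hpar] at h1
      rw [hxq, hoff l hpar] at h2
      exact hp.2.2.2 (u l) (hq.2.2.1.trans_lt h1) (mem_oddDiagram.2 ⟨h2, hl, hpar.symm⟩)
    · intro l hl hl' hpar h1
      rw [hxp, hoff l hpar] at h1
      rw [h.freePos_parity hp] at hpar
      exact lt_asymm (h.gt_of_odd (hp.1.trans_lt hl) hpar (hq.2.2.1.trans h1.le))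
        (hl'.trans_le hq.2.1)
  have heq := bruhatLE_antisymm hxu ((h.mem_iff x).1 hdiag.symm).1
  rw [heq] at hxp
  exact hpq.ne (u.injective hxp)

theorem decreasing (h : IsClass u v k) {p q : Fin n} (hp : FreePos u v k p)
    (hq : FreePos u v k q) (hpq : p < q) : v q < v p := by
  by_contra! hle
  have hlt : v p < v q := lt_of_le_of_ne hle (v.injective.ne hpq.ne)
  have hdiag : oddDiagram (v * swap p q) = oddDiagram v := by
    have hkp := h.le_iff.1 hp.2.2.1
    refine oddDiagram_mul_swap hpq hlt
      ((h.freePos_parity hp).trans (h.freePos_parity hq).symm) ?_ ?_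
    · intro l hl hpar h1 h2
      have hk : k ≤ u l := h.le_iff.2 (hkp.trans h1.le)
      have hpar' := hpar
      rw [h.freePos_parity hp] at hpar'
      have hbl := h.gt_of_odd (hp.1.trans_lt hl) hpar' hk
      refine hq.2.2.2 (v l) (hkp.trans_lt h1) ?_
      rw [← h.diag_eq, mem_oddDiagram, h.freePos_parity hq]
      exact ⟨h2, hq.2.1.trans_lt hbl, hpar'.symm⟩
    · intro l hl hl' hpar h1
      rw [h.freePos_parity hp] at hpar
      exact lt_asymm (h.gt_of_odd (hp.1.trans_lt hl) hpar (h.le_iff.2 (hkp.trans h1.le)))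
        (hl'.trans_le hq.2.1)
  have heq := bruhatLE_antisymm (bruhatLE_mul_swap hpq hlt)
    ((h.mem_iff _).1 (hdiag.trans h.diag_eq)).2
  have := congrArg (fun z : Perm (Fin n) => z p) heq
  simp only [Perm.mul_apply, swap_apply_left] at this
  exact hpq.ne (v.injective this)

theorem freePos_iff (h : IsClass u v k) {p : Fin n} :
    FreePos u v k p ↔ u⁻¹ k ≤ p ∧ p ≤ v⁻¹ k ∧ k ≤ u p ∧ u p ≤ u (v⁻¹ k) := by
  constructor
  · intro hp
    refine ⟨hp.1, hp.2.1, hp.2.2.1, ?_⟩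
    rcases hp.2.1.eq_or_lt with heq | hlt
    · rw [heq]
    · exact (h.increasing hp h.freePos_right hlt).le
  · rintro ⟨h1, h2, h3, h4⟩
    refine ⟨h1, h2, h3, fun y hy hmem => ?_⟩
    have hpar := h.parity_of_window h1 h2 h3
    obtain ⟨l, rfl⟩ := u.surjective y
    rw [mem_oddDiagram, hpar] at hmem
    have hbl := h.gt_of_odd (h1.trans_lt hmem.2.1) hmem.2.2.symm hy.le
    refine h.freePos_right.2.2.2 _ hy ?_
    rw [mem_oddDiagram, ← h.parity]
    exact ⟨hmem.1.trans_le h4, hbl, hmem.2.2⟩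

theorem freePos_of_le_left (h : IsClass u v k) {p : Fin n} (h1 : u⁻¹ k ≤ p) (h2 : p ≤ v⁻¹ k)
    (h3 : k ≤ v p) (h4 : v p ≤ v (u⁻¹ k)) : FreePos u v k p := by
  have hk := h.le_iff.2 h3
  refine ⟨h1, h2, hk, fun y hy hmem => ?_⟩
  have hpar := h.parity_of_window h1 h2 hk
  refine h.freePos_left.2.2.2 y hy ?_
  rw [← h.diag_eq] at hmem ⊢
  obtain ⟨l, rfl⟩ := v.surjective y
  rw [mem_oddDiagram, hpar] at hmem
  rw [mem_oddDiagram]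
  exact ⟨hmem.1.trans_le h4, h1.trans_lt hmem.2.1, hmem.2.2⟩

/-- Window entries of `u` not smaller than `k` are bounded below by the entry at a free position
which no free position among them precedes. -/
theorem le_of_window (h : IsClass u v k) {p' l : Fin n} (hp' : FreePos u v k p')
    (h1 : u⁻¹ k ≤ l) (h2 : l ≤ v⁻¹ k) (hk : k ≤ u l) (hl : FreePos u v k l → p' ≤ l) :
    u p' ≤ u l := by
  by_cases hf : FreePos u v k l
  · rcases (hl hf).eq_or_lt with rfl | hlt
    · exact le_rfl
    · exact (h.increasing hp' hf hlt).le
  · have h3 : u (v⁻¹ k) < u l := by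
      by_contra! hle
      exact hf (h.freePos_iff.2 ⟨h1, h2, hk, hle⟩)
    exact ((h.freePos_iff.1 hp').2.2.2).trans h3.le

theorem le_of_window_top (h : IsClass u v k) {p' l : Fin n} (hp' : FreePos u v k p')
    (h1 : u⁻¹ k ≤ l) (h2 : l ≤ v⁻¹ k) (hk : k ≤ v l) (hl : FreePos u v k l → l ≤ p') :
    v p' ≤ v l := by
  by_cases hf : FreePos u v k l
  · rcases (hl hf).eq_or_lt with rfl | hlt
    · exact le_rfl
    · exact (h.decreasing hf hp' hlt).le
  · have h3 : v (u⁻¹ k) < v l := by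
      by_contra! hle
      exact hf (h.freePos_of_le_left h1 h2 hk hle)
    refine le_trans ?_ h3.le
    rcases hp'.1.eq_or_lt with heq | hlt
    · rw [heq]
    · exact (h.decreasing h.freePos_left hp' hlt).le

end IsClass

end BruhatBlock

/-- With the standing setup, the block `[u,v]⁽ⁱ⁾` is the Bruhat interval `[uᵢ, vᵢ]`. -/
theorem block_is_interval {n : ℕ} (D : Set (Fin n × Fin n)) (u v : Equiv.Perm (Fin n))
    (hu : oddDiagram u = D) (hv : oddDiagram v = D) (hne : u ≠ v)
    (hint : ∀ w : Equiv.Perm (Fin n), oddDiagram w = D ↔ (bruhatLE u w ∧ bruhatLE w v))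
    (k : Fin n) (hk : u⁻¹ k ≠ v⁻¹ k) (hkmin : ∀ i : Fin n, i < k → u⁻¹ i = v⁻¹ i)
    (m : ℕ) (hm : 0 < m) (aseq : Fin m → Fin n) (hmono : StrictMono aseq)
    (hrange : ∀ i : Fin n, (∃ j : Fin m, aseq j = i) ↔
      (u⁻¹ k ≤ i ∧ i ≤ v⁻¹ k ∧ u (u⁻¹ k) ≤ u i ∧ u i ≤ u (v⁻¹ k)))
    (useq : Fin m → Equiv.Perm (Fin n))
    (huseq0 : useq ⟨0, hm⟩ = u)
    (huseqS : ∀ (i : ℕ) (h : i + 1 < m),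
      useq ⟨i + 1, h⟩ = useq ⟨i, Nat.lt_of_succ_lt h⟩ *
        Equiv.swap (aseq ⟨i, Nat.lt_of_succ_lt h⟩) (aseq ⟨i + 1, h⟩))
    (vseq : Fin m → Equiv.Perm (Fin n))
    (hvseqm : vseq ⟨m - 1, Nat.sub_lt hm Nat.one_pos⟩ = v)
    (hvseqS : ∀ (i : ℕ) (h : i + 1 < m),
      vseq ⟨i, Nat.lt_of_succ_lt h⟩ = vseq ⟨i + 1, h⟩ *
        Equiv.swap (aseq ⟨i, Nat.lt_of_succ_lt h⟩) (aseq ⟨i + 1, h⟩)) :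
    ∀ (j : Fin m) (w : Equiv.Perm (Fin n)),
      (bruhatLE u w ∧ bruhatLE w v ∧ w⁻¹ k = aseq j) ↔
      (bruhatLE (useq j) w ∧ bruhatLE w (vseq j)) := by
  subst hu
  have hC : BruhatBlock.IsClass u v k := ⟨hint, hkmin, hk⟩
  have hfree : ∀ p, (∃ t, aseq t = p) ↔ BruhatBlock.FreePos u v k p := by
    intro p
    rw [hrange, hC.freePos_iff, BruhatBlock.apply_inv_self]
  have hfa : ∀ t, BruhatBlock.FreePos u v k (aseq t) := fun t => (hfree _).1 ⟨t, rfl⟩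
  have hfirst : aseq ⟨0, hm⟩ = u⁻¹ k := by
    obtain ⟨t, ht⟩ := (hfree _).2 hC.freePos_left
    refine le_antisymm ?_ (hfa _).1
    rw [← ht]
    exact hmono.monotone (Nat.zero_le _)
  have hlast : aseq ⟨m - 1, Nat.sub_lt hm Nat.one_pos⟩ = v⁻¹ k := by
    obtain ⟨t, ht⟩ := (hfree _).2 hC.freePos_right
    refine le_antisymm (hfa _).2.1 ?_
    rw [← ht]
    exact hmono.monotone (Nat.le_sub_one_of_lt t.2)
  have hgap : ∀ (i : ℕ) (h : i + 1 < m) (p), BruhatBlock.FreePos u v k p →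
      aseq ⟨i, Nat.lt_of_succ_lt h⟩ < p → aseq ⟨i + 1, h⟩ ≤ p := by
    intro i h p hp hlt
    obtain ⟨t, rfl⟩ := (hfree _).2 hp
    exact hmono.monotone (Nat.succ_le_of_lt (hmono.lt_iff_lt.1 hlt))
  have hgap' : ∀ (i : ℕ) (h : i + 1 < m) (p), BruhatBlock.FreePos u v k p →
      p < aseq ⟨i + 1, h⟩ → p ≤ aseq ⟨i, Nat.lt_of_succ_lt h⟩ := by
    intro i h p hp hlt
    by_contra! hlt'
    exact absurd hlt (not_lt.2 (hgap i h p hp hlt'))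
  have hstep : ∀ (i : ℕ) (h : i + 1 < m),
      aseq ⟨i, Nat.lt_of_succ_lt h⟩ < aseq ⟨i + 1, h⟩ := fun i h => hmono (Nat.lt_succ_self i)
  have hupos : ∀ (i : ℕ) (h : i + 1 < m), k < u (aseq ⟨i + 1, h⟩) := by
    intro i h
    have := hC.increasing hC.freePos_left (hfa ⟨i + 1, h⟩) ((hfa _).1.trans_lt (hstep i h))
    rwa [BruhatBlock.apply_inv_self] at this
  have hvpos : ∀ (i : ℕ) (h : i + 1 < m), k < v (aseq ⟨i, Nat.lt_of_succ_lt h⟩) := by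
    intro i h
    have := hC.decreasing (hfa ⟨i, Nat.lt_of_succ_lt h⟩) hC.freePos_right
      ((hstep i h).trans_le (hfa _).2.1)
    rwa [BruhatBlock.apply_inv_self] at this
  have hU : ∀ (i : ℕ) (h : i < m), bruhatLE u (useq ⟨i, h⟩) ∧ useq ⟨i, h⟩ (aseq ⟨i, h⟩) = k ∧
      (∀ l, aseq ⟨i, h⟩ < l → useq ⟨i, h⟩ l = u l) ∧
      BruhatBlock.AgreeBelow k u (useq ⟨i, h⟩) := by
    intro i
    induction i with
    | zero =>
      intro h
      rw [huseq0, hfirst]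
      exact ⟨Relation.ReflTransGen.refl, BruhatBlock.apply_inv_self u k, fun _ _ => rfl,
        fun _ _ => rfl⟩
    | succ i ih =>
      intro h
      obtain ⟨h1, h2, h3, h4⟩ := ih (Nat.lt_of_succ_lt h)
      have h5 := h3 _ (hstep i h)
      have h6 := hupos i h
      rw [huseqS i h]
      refine ⟨h1.trans (BruhatBlock.bruhatLE_mul_swap (hstep i h) ?_), ?_, fun l hl => ?_,
        h4.trans (BruhatBlock.AgreeBelow.mul_swap h2.ge (h5 ▸ h6.le))⟩
      · rwa [h2, h5]
      · rw [Perm.mul_apply, swap_apply_right, h2]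
      · rw [Perm.mul_apply, swap_apply_of_ne_of_ne ((hstep i h).trans hl).ne' hl.ne',
          h3 l ((hstep i h).trans hl)]
  have hV : ∀ (i : ℕ) (h : i < m), bruhatLE (vseq ⟨i, h⟩) v ∧ vseq ⟨i, h⟩ (aseq ⟨i, h⟩) = k ∧
      (∀ l, l < aseq ⟨i, h⟩ → vseq ⟨i, h⟩ l = v l) ∧
      BruhatBlock.AgreeBelow k v (vseq ⟨i, h⟩) := by
    intro i hi
    refine Nat.decreasingInduction' (n := m - 1) (m := i) (P := fun i => ∀ h : i < m,
      bruhatLE (vseq ⟨i, h⟩) v ∧ vseq ⟨i, h⟩ (aseq ⟨i, h⟩) = k ∧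
      (∀ l, l < aseq ⟨i, h⟩ → vseq ⟨i, h⟩ l = v l) ∧
      BruhatBlock.AgreeBelow k v (vseq ⟨i, h⟩)) ?_ (Nat.le_sub_one_of_lt hi) ?_ hi
    · intro i him _ ih _
      have h : i + 1 < m := by omega
      obtain ⟨h1, h2, h3, h4⟩ := ih h
      have h5 := h3 _ (hstep i h)
      have h6 := hvpos i h
      have hsw : vseq ⟨i + 1, h⟩ = vseq ⟨i, Nat.lt_of_succ_lt h⟩ *
          swap (aseq ⟨i, Nat.lt_of_succ_lt h⟩) (aseq ⟨i + 1, h⟩) := by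
        rw [hvseqS i h, mul_assoc, swap_mul_self, mul_one]
      have h7 : vseq ⟨i, Nat.lt_of_succ_lt h⟩ (aseq ⟨i, Nat.lt_of_succ_lt h⟩) = k := by
        rw [hvseqS i h, Perm.mul_apply, swap_apply_left, h2]
      refine ⟨Relation.ReflTransGen.trans ?_ h1, h7, fun l hl => ?_, ?_⟩
      · rw [hsw]
        refine BruhatBlock.bruhatLE_mul_swap (hstep i h) ?_
        rw [h7, hvseqS i h, Perm.mul_apply, swap_apply_right, h5]
        exact h6
      · rw [hvseqS i h, Perm.mul_apply,
          swap_apply_of_ne_of_ne hl.ne (hl.trans (hstep i h)).ne, h3 l (hl.trans (hstep i h))]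
      · rw [hvseqS i h]
        exact h4.trans (BruhatBlock.AgreeBelow.mul_swap (h5 ▸ h6.le) h2.ge)
    · intro h
      rw [hvseqm, hlast]
      exact ⟨Relation.ReflTransGen.refl, BruhatBlock.apply_inv_self v k, fun _ _ => rfl,
        fun _ _ => rfl⟩
  intro j w
  constructor
  · rintro ⟨huw, hwv, hwk⟩
    have hag : BruhatBlock.AgreeBelow k u w := BruhatBlock.AgreeBelow.of_between
      (BruhatBlock.RankLE.of_bruhatLE huw) (BruhatBlock.RankLE.of_bruhatLE hwv) hkmin
    constructor
    · have key : ∀ (i : ℕ) (h : i < m), i ≤ j → bruhatLE (useq ⟨i, h⟩) w := by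
        intro i
        induction i with
        | zero => intro h _; rw [huseq0]; exact huw
        | succ i ih =>
          intro h hij
          obtain ⟨-, h2, h3, h4⟩ := hU i (Nat.lt_of_succ_lt h)
          rw [huseqS i h]
          refine BruhatBlock.bruhatLE_step (ih (Nat.lt_of_succ_lt h) (Nat.le_of_succ_le hij))
            (h4.symm.trans hag) h2 (hstep i h) ?_ ?_ ?_
          · rw [hwk]; exact hmono.monotone hij
          · rw [h3 _ (hstep i h)]; exact hupos i h
          · intro l hl hlw hkl
            rw [h3 _ (hstep i h), h3 l hl]
            rw [h3 l hl] at hkl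
            rw [hwk] at hlw
            exact hC.le_of_window (hfa _) ((hfa _).1.trans hl.le) (hlw.trans (hfa _).2.1) hkl.le
              fun hf => hgap i h l hf hl
      exact key j j.2 le_rfl
    · have hagv : BruhatBlock.AgreeBelow k w v := hag.symm.trans hkmin
      refine Nat.decreasingInduction' (n := m - 1) (m := j) (P := fun i => ∀ h : i < m,
        bruhatLE w (vseq ⟨i, h⟩)) ?_ (Nat.le_sub_one_of_lt j.2) ?_ j.2
      · intro i him hji ih _
        have h : i + 1 < m := by omega
        obtain ⟨-, h2, h3, h4⟩ := hV (i + 1) h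
        rw [hvseqS i h]
        refine BruhatBlock.bruhatLE_step_down (ih h) (hagv.trans h4) h2 (hstep i h) ?_ ?_ ?_
        · rw [hwk]; exact hmono.monotone hji
        · rw [h3 _ (hstep i h)]; exact hvpos i h
        · intro l hl hlw hkl
          rw [h3 _ (hstep i h), h3 l hl]
          rw [h3 l hl] at hkl
          rw [hwk] at hlw
          exact hC.le_of_window_top (hfa _) ((hfa _).1.trans hlw) (hl.le.trans (hfa _).2.1) hkl.le
            fun hf => hgap' i h l hf hl
      · intro h
        rw [hvseqm]
        exact hwv
  · rintro ⟨h1, h2⟩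
    obtain ⟨hu1, hu2, -, hu4⟩ := hU j j.2
    obtain ⟨hv1, hv2, -, hv4⟩ := hV j j.2
    have huw := hu1.trans h1
    have hwv := h2.trans hv1
    have hag : BruhatBlock.AgreeBelow k u w := BruhatBlock.AgreeBelow.of_between
      (BruhatBlock.RankLE.of_bruhatLE huw) (BruhatBlock.RankLE.of_bruhatLE hwv) hkmin
    refine ⟨huw, hwv, le_antisymm ?_ ?_⟩
    · have := (BruhatBlock.RankLE.of_bruhatLE h2).inv_le (hag.symm.trans (hC.agree.trans hv4))
      rwa [Perm.inv_eq_iff_eq.2 hv2.symm] at this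
    · have := (BruhatBlock.RankLE.of_bruhatLE h1).inv_le (hu4.symm.trans hag)
      rwa [Perm.inv_eq_iff_eq.2 hu2.symm] at this
end

section
/- With the standing setup, for each 1 ≤ i ≤ m-1 the Poincaré polynomials of the intervals [u_i, v_i] and [u_{i+1}, v_{i+1}] are equal: P_{u_i, v_i}(t) = P_{u_{i+1}, v_{i+1}}(t). -/
open Equiv Finset Polynomial

open Classical in
/-- The Poincaré polynomial of the Bruhat interval `[u, v]`:
`P_{u,v}(t) = t^{-ℓ(u)} Σ_{u ≤ w ≤ v} t^{ℓ(w)}`. -/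
noncomputable def poincare {n : ℕ} (u v : Equiv.Perm (Fin n)) : Polynomial ℤ :=
  ∑ w : Equiv.Perm (Fin n),
    if bruhatLE u w ∧ bruhatLE w v then (X : Polynomial ℤ) ^ (invLength w - invLength u) else 0

section OddDiagram

variable {n : ℕ}

theorem mem_oddDiagram_apply {w : Perm (Fin n)} {i j : Fin n} :
    (i, w j) ∈ oddDiagram w ↔ w j < w i ∧ i < j ∧ (i : ℕ) % 2 ≠ (j : ℕ) % 2 := by
  simp [oddDiagram]

theorem exists_of_mem_oddDiagram {w : Perm (Fin n)} {i c : Fin n} (h : (i, c) ∈ oddDiagram w) :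
    ∃ j, w j = c ∧ c < w i ∧ i < j ∧ (i : ℕ) % 2 ≠ (j : ℕ) % 2 :=
  ⟨w⁻¹ c, by simp, h⟩

/-- Swapping the values at `p < q`, where `x p < x q`, preserves the odd diagram only under
these conditions. -/
theorem conditions_of_oddDiagram_mul_swap {x : Perm (Fin n)} {p q : Fin n} (hpq : p < q)
    (hx : x p < x q) (h : oddDiagram (x * swap p q) = oddDiagram x) :
    (p : ℕ) % 2 = (q : ℕ) % 2 ∧
    (∀ r, p < r → r < q → (r : ℕ) % 2 ≠ (p : ℕ) % 2 → x r < x p) ∧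
    (∀ r, q < r → (r : ℕ) % 2 ≠ (p : ℕ) % 2 → x p < x r → x q ≤ x r) := by
  have key : ∀ i j, (x j < x i ∧ i < j ∧ (i : ℕ) % 2 ≠ (j : ℕ) % 2) ↔
      (x j < x (swap p q i) ∧ i < swap p q j ∧ (i : ℕ) % 2 ≠ (swap p q j : ℕ) % 2) := by
    intro i j
    have h1 := mem_oddDiagram_apply (w := x) (i := i) (j := j)
    have h2 := mem_oddDiagram_apply (w := x * swap p q) (i := i) (j := swap p q j)
    simp only [Perm.mul_apply, swap_apply_self] at h2
    rw [← h1, ← h2, h]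
  refine ⟨?_, ?_, ?_⟩
  · have := key p p
    simp only [swap_apply_left] at this
    grind
  · intro r h1 h2 h3
    have hp := key r p
    rw [swap_apply_left, swap_apply_of_ne_of_ne h1.ne' h2.ne] at hp
    have : x r ≠ x p := fun e => h1.ne' (x.injective e)
    by_contra h4
    have := hp.2 ⟨by order, h2, by grind⟩
    order
  · intro r h1 h2 h3
    have hp := key q r
    rw [swap_apply_right, swap_apply_of_ne_of_ne (by order) h1.ne'] at hp
    by_contra h4
    grind

theorem oddDiagram_mul_swap {x : Perm (Fin n)} {p q : Fin n} (hpq : p < q) (hx : x p < x q)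
    (hpar : (p : ℕ) % 2 = (q : ℕ) % 2)
    (hmid : ∀ r, p < r → r < q → (r : ℕ) % 2 ≠ (p : ℕ) % 2 → x r < x p)
    (hright : ∀ r, q < r → (r : ℕ) % 2 ≠ (p : ℕ) % 2 → x p < x r → x q ≤ x r) :
    oddDiagram (x * swap p q) = oddDiagram x := by
  have inj : ∀ i j, x i = x j → i = j := fun i j e => x.injective e
  have key : ∀ i j, (x j < x (swap p q i) ∧ i < swap p q j ∧
      (i : ℕ) % 2 ≠ (swap p q j : ℕ) % 2) ↔
      (x j < x i ∧ i < j ∧ (i : ℕ) % 2 ≠ (j : ℕ) % 2) := by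
    intro i j
    simp only [swap_apply_def]
    grind
  ext ⟨i, c⟩
  obtain ⟨j, rfl⟩ := x.surjective c
  rw [mem_oddDiagram_apply, ← key]
  have h2 := mem_oddDiagram_apply (w := x * swap p q) (i := i) (j := swap p q j)
  simpa only [Perm.mul_apply, swap_apply_self] using h2

/-- The positions of the values of `w`, in lexicographic order. -/
def positionsLex (w : Perm (Fin n)) : Lex (Fin n → Fin n) := toLex fun i => w⁻¹ i

theorem positionsLex_lt_mul_swap {x : Perm (Fin n)} {p q : Fin n} (hpq : p < q)
    (hx : x p < x q) : positionsLex x < positionsLex (x * swap p q) := by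
  refine ⟨x p, fun j hj => ?_, ?_⟩
  · obtain ⟨i, rfl⟩ := x.surjective j
    have hj' : x i < x p := hj
    have h1 : i ≠ p := by rintro rfl; order
    have h2 : i ≠ q := by rintro rfl; order
    simp [positionsLex, swap_apply_of_ne_of_ne h1 h2]
  · simpa [positionsLex] using hpq

theorem bruhatLE.positionsLex_le {x y : Perm (Fin n)} (h : bruhatLE x y) :
    positionsLex x ≤ positionsLex y := by
  induction h with
  | refl => exact le_rfl
  | tail _ hs ih =>
    obtain ⟨i, j, hij, hlt, rfl⟩ := hs
    exact ih.trans (positionsLex_lt_mul_swap hij hlt).le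

theorem bruhatLE.trans {x y z : Perm (Fin n)} (h : bruhatLE x y) (h' : bruhatLE y z) :
    bruhatLE x z := Relation.ReflTransGen.trans h h'

theorem bruhatLE_mul_swap {x : Perm (Fin n)} {i j : Fin n} (hij : i < j) (h : x i < x j) :
    bruhatLE x (x * swap i j) := Relation.ReflTransGen.single ⟨i, j, hij, h, rfl⟩

theorem not_bruhatLE_mul_swap {x : Perm (Fin n)} {i j : Fin n} (hij : i < j) (h : x i < x j) :
    ¬ bruhatLE (x * swap i j) x := fun hle =>
  (positionsLex_lt_mul_swap hij h).not_ge hle.positionsLex_le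

theorem bruhatLE.inv_apply_le {x y : Perm (Fin n)} (h : bruhatLE x y) {k : Fin n}
    (hk : ∀ i < k, x⁻¹ i = y⁻¹ i) : x⁻¹ k ≤ y⁻¹ k := by
  by_contra hlt
  refine h.positionsLex_le.not_gt ⟨k, fun j hj => ?_, ?_⟩
  · simpa [positionsLex] using (hk j hj).symm
  · simpa [positionsLex] using hlt

/-- If `x` and `y` have the values below `k` in the same positions, so does everything in the
Bruhat interval `[x, y]`. -/
theorem bruhatLE.inv_apply_eq {x w y : Perm (Fin n)} (h : bruhatLE x w) (h' : bruhatLE w y)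
    {k : Fin n} (hk : ∀ i < k, x⁻¹ i = y⁻¹ i) (i : Fin n) (hi : i < k) : w⁻¹ i = x⁻¹ i := by
  induction i using WellFoundedLT.induction with
  | ind i ih =>
    have h1 := h.inv_apply_le fun j hj => (ih j hj (hj.trans hi)).symm
    have h2 := h'.inv_apply_le fun j hj => (ih j hj (hj.trans hi)).trans (hk j (hj.trans hi))
    rw [← hk i hi] at h2
    exact le_antisymm h2 h1

theorem bruhatLE.mul_right_of_forall {x y s : Perm (Fin n)} (h : bruhatLE x y)
    (hstep : ∀ z p q, bruhatLE x z → bruhatLE (z * swap p q) y → p < q → z p < z q →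
      bruhatLE (z * s) (z * swap p q * s)) : bruhatLE (x * s) (y * s) := by
  induction h with
  | refl => exact Relation.ReflTransGen.refl
  | @tail b c hxb hs ih =>
    obtain ⟨p, q, hpq, hlt, rfl⟩ := hs
    refine (ih fun z i j hz hz' => hstep z i j hz (hz'.trans ?_)).trans
      (hstep b p q hxb Relation.ReflTransGen.refl hpq hlt)
    exact bruhatLE_mul_swap hpq hlt

theorem mul_swap_mul_eq (z s : Perm (Fin n)) (p q : Fin n) :
    z * swap p q * s = z * s * swap (s⁻¹ p) (s⁻¹ q) := by
  rw [mul_assoc, mul_assoc, Equiv.swap_mul_eq_mul_swap]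

theorem invLength_mul_swap_of_cover {x : Perm (Fin n)} {p q : Fin n} (hpq : p < q)
    (hx : x p < x q) (hmid : ∀ r, p < r → r < q → x p < x r → x q ≤ x r) :
    invLength (x * swap p q) = invLength x + 1 := by
  have inj : ∀ i j, x i = x j → i = j := fun i j e => x.injective e
  let f : Fin n × Fin n → Fin n × Fin n := fun r =>
    if swap p q r.1 < swap p q r.2 then (swap p q r.1, swap p q r.2) else r
  have hmem : (p, q) ∈ Finset.univ.filter (fun r : Fin n × Fin n =>
      r.1 < r.2 ∧ (x * swap p q) r.2 < (x * swap p q) r.1) := by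
    rw [Finset.mem_filter]
    exact ⟨Finset.mem_univ _, hpq, by simpa using hx⟩
  unfold invLength
  rw [← Finset.card_erase_add_one hmem]
  congr 1
  refine Finset.card_nbij' f f ?_ ?_ ?_ ?_ <;>
  · rintro ⟨i, j⟩
    simp only [f, Finset.coe_erase, Finset.coe_filter, Finset.mem_univ, true_and, Set.mem_sdiff,
      Set.mem_ofPred_eq, Set.mem_singleton_iff, Perm.mul_apply, swap_apply_def, Prod.mk.injEq]
    grind

/-- The odd diagram class of `u` is the Bruhat interval `[u, v]`, and `k` is the smallest value
whose position differs in `u` and `v`. -/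
structure IsClassInterval (u v : Perm (Fin n)) (k : Fin n) : Prop where
  oddDiagram_eq_iff : ∀ w, oddDiagram w = oddDiagram u ↔ bruhatLE u w ∧ bruhatLE w v
  ne : u⁻¹ k ≠ v⁻¹ k
  inv_eq : ∀ i < k, u⁻¹ i = v⁻¹ i

/-- The positions between those of `k` in `u` and in `v` whose `u`-value is also between
the corresponding values. -/
def IsBlock (u v : Perm (Fin n)) (k i : Fin n) : Prop :=
  u⁻¹ k ≤ i ∧ i ≤ v⁻¹ k ∧ k ≤ u i ∧ u i ≤ u (v⁻¹ k)

namespace IsClassInterval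

variable {u v x : Perm (Fin n)} {k : Fin n} (H : IsClassInterval u v k)

theorem mem_column_iff {i : Fin n} : (i, k) ∈ oddDiagram u ↔
    k < u i ∧ i < u⁻¹ k ∧ (i : ℕ) % 2 ≠ (u⁻¹ k : Fin n) % 2 := Iff.rfl

include H

theorem bruhatLE_right : bruhatLE u v := ((H.oddDiagram_eq_iff u).1 rfl).2

theorem oddDiagram_right : oddDiagram v = oddDiagram u :=
  (H.oddDiagram_eq_iff v).2 ⟨H.bruhatLE_right, Relation.ReflTransGen.refl⟩

theorem inv_apply_eq (hx : oddDiagram x = oddDiagram u) {i : Fin n} (hi : i < k) :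
    x⁻¹ i = u⁻¹ i := by
  obtain ⟨h1, h2⟩ := (H.oddDiagram_eq_iff x).1 hx
  exact h1.inv_apply_eq h2 H.inv_eq i hi

theorem apply_lt_iff (hx : oddDiagram x = oddDiagram u) (i : Fin n) : x i < k ↔ u i < k := by
  constructor <;> intro h <;>
  · have := H.inv_apply_eq hx h
    rw [Perm.inv_eq_iff_eq] at this
    simp at this
    grind

theorem lt : u⁻¹ k < v⁻¹ k :=
  lt_of_le_of_ne (H.bruhatLE_right.inv_apply_le H.inv_eq) H.ne

theorem lt_apply_right : k < u (v⁻¹ k) := by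
  refine lt_of_le_of_ne (not_lt.1 fun h => ?_) fun h => ?_
  · rw [← H.apply_lt_iff H.oddDiagram_right] at h
    simp at h
  · exact H.ne (by rw [Perm.inv_eq_iff_eq]; exact h)

theorem lt_apply_left : k < v (u⁻¹ k) := by
  refine lt_of_le_of_ne (not_lt.1 fun h => ?_) fun h => ?_
  · rw [H.apply_lt_iff H.oddDiagram_right] at h
    simp at h
  · exact H.ne (by rw [eq_comm, Perm.inv_eq_iff_eq]; exact h)

theorem mem_column_iff_right {i : Fin n} : (i, k) ∈ oddDiagram u ↔
    k < v i ∧ i < v⁻¹ k ∧ (i : ℕ) % 2 ≠ (v⁻¹ k : Fin n) % 2 := by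
  rw [← H.oddDiagram_right]
  rfl

theorem parity : (u⁻¹ k : Fin n) % 2 = ((v⁻¹ k : Fin n) : ℕ) % 2 := by
  by_contra h
  have := mem_column_iff.1 (H.mem_column_iff_right.2 ⟨H.lt_apply_left, H.lt, h⟩)
  exact this.2.1.false

theorem apply_lt_of_parity_ne {r : Fin n} (h1 : u⁻¹ k ≤ r) (h2 : r ≤ v⁻¹ k)
    (h3 : (r : ℕ) % 2 ≠ (v⁻¹ k : Fin n) % 2) : u r < k := by
  rw [← H.apply_lt_iff H.oddDiagram_right]
  have hne : r ≠ v⁻¹ k := by rintro rfl; exact h3 rfl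
  have hv : v r ≠ k := fun h => hne (by rw [eq_comm, Perm.inv_eq_iff_eq]; exact h.symm)
  by_contra h
  have := mem_column_iff.1 (H.mem_column_iff_right.2 ⟨by order, by order, h3⟩)
  order

theorem parity_of_le_apply {r : Fin n} (h1 : u⁻¹ k ≤ r) (h2 : r ≤ v⁻¹ k) (h3 : k ≤ u r) :
    (r : ℕ) % 2 = (v⁻¹ k : Fin n) % 2 := by
  by_contra h
  exact h3.not_gt (H.apply_lt_of_parity_ne h1 h2 h)

theorem lt_of_mem_row {i c : Fin n} (hi : IsBlock u v k i) (h : (i, c) ∈ oddDiagram u) :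
    c < k := by
  obtain ⟨h1, h2, h3, h4⟩ := hi
  have hpar := H.parity_of_le_apply h1 h2 h3
  obtain ⟨r, rfl, hr1, hr2, hr3⟩ := exists_of_mem_oddDiagram h
  rcases le_or_gt r (v⁻¹ k) with hb | hb
  · exact H.apply_lt_of_parity_ne (by order) hb (by grind)
  · have : (v⁻¹ k, u r) ∈ oddDiagram u :=
      mem_oddDiagram_apply.2 ⟨by order, hb, by grind⟩
    rw [← H.oddDiagram_right] at this
    simpa using this.1

theorem exists_mem_row {q : Fin n} (h1 : u⁻¹ k ≤ q) (h2 : q ≤ v⁻¹ k) (h3 : u (v⁻¹ k) < u q) :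
    ∃ c, u (v⁻¹ k) < c ∧ (q, c) ∈ oddDiagram u := by
  have hk := H.lt_apply_right
  have hpar := H.parity_of_le_apply h1 h2 (by order)
  have hlt : q < v⁻¹ k := lt_of_le_of_ne h2 (by rintro rfl; order)
  by_contra! hno
  let z := u * swap q (v⁻¹ k)
  have hz : z * swap q (v⁻¹ k) = u := by simp [z, mul_assoc]
  have hzlt : z q < z (v⁻¹ k) := by simpa [z] using h3
  have hzr : ∀ r, r ≠ q → r ≠ v⁻¹ k → z r = u r := fun r hr hr' => by
    simp [z, swap_apply_of_ne_of_ne hr (by simpa using hr')]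
  have hzq : z q = u (v⁻¹ k) := by simp [z]
  have hzb : z (v⁻¹ k) = u q := by simp [z]
  have key := oddDiagram_mul_swap hlt hzlt hpar
    (fun r hr hr' hp => by
      have := H.apply_lt_of_parity_ne (r := r) (by order) hr'.le (by grind)
      rw [hzr r (by order) (by order), hzq]
      order)
    (fun r hr hp hlt' => by
      rw [hzr r (by order) (by order), hzq] at hlt'
      rw [hzr r (by order) (by order), hzb]
      by_contra hcon
      exact hno (u r) hlt' (mem_oddDiagram_apply.2 ⟨by order, by order, by grind⟩))
  rw [hz] at key
  have hle := ((H.oddDiagram_eq_iff z).1 key.symm).1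
  rw [← hz] at hle
  refine not_bruhatLE_mul_swap hlt hzlt ?_
  rwa [hz] at hle ⊢

theorem exists_of_right_lt {q : Fin n} (h1 : v⁻¹ k < q)
    (h2 : (q : ℕ) % 2 = (v⁻¹ k : Fin n) % 2) (h3 : k < v q) :
    (∃ c, k < c ∧ (q, c) ∈ oddDiagram u) ∨
      ∃ r, v⁻¹ k < r ∧ r < q ∧ (r : ℕ) % 2 ≠ (q : ℕ) % 2 ∧ k < v r := by
  by_contra! hno
  obtain ⟨hrow, hmid⟩ := hno
  have hvk : v (v⁻¹ k) = k := by simp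
  have hlt : v (v⁻¹ k) < v q := by rwa [hvk]
  have key := oddDiagram_mul_swap h1 hlt h2.symm
    (fun r hr hr' hp => lt_of_le_of_ne (hvk.symm ▸ hmid r hr hr' (by grind))
      (fun e => hr.ne' (v.injective e)))
    (fun r hr hp hlt' => by
      by_contra hcon
      rw [hvk] at hlt'
      refine hrow (v r) hlt' ?_
      rw [← H.oddDiagram_right]
      exact mem_oddDiagram_apply.2 ⟨by order, hr, by grind⟩)
  rw [H.oddDiagram_right] at key
  exact not_bruhatLE_mul_swap h1 hlt ((H.oddDiagram_eq_iff _).1 key).2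

theorem isBlock_of_step {p q : Fin n} (hx : oddDiagram x = oddDiagram u)
    (hy : oddDiagram (x * swap p q) = oddDiagram u) (hpq : p < q) (hlt : x p < x q)
    (hp : IsBlock u v k p) : IsBlock u v k q := by
  obtain ⟨hpar, hmid, hright⟩ := conditions_of_oddDiagram_mul_swap hpq hlt (hy.trans hx.symm)
  have ⟨h1, h2, h3, _⟩ := hp
  have hppar := H.parity_of_le_apply h1 h2 h3
  have hxp : k ≤ x p := not_lt.1 fun h => h3.not_gt ((H.apply_lt_iff hx p).1 h)
  have hM := H.lt_apply_right
  have hrow : ∀ r, p < r → (r : ℕ) % 2 ≠ (p : ℕ) % 2 → x r < x p → x r < k := fun r hr hr' h =>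
    H.lt_of_mem_row hp (hx ▸ mem_oddDiagram_apply.2 ⟨h, hr, by grind⟩)
  have hnot : ∀ c, k < c → (q, c) ∉ oddDiagram u := fun c hc hmem => by
    rw [← hx] at hmem
    obtain ⟨r, rfl, hr1, hr2, hr3⟩ := exists_of_mem_oddDiagram hmem
    have hne : x r ≠ x p := fun e => by have := x.injective e; order
    rcases lt_or_gt_of_ne hne with h | h
    · exact (hrow r (by order) (by grind) h).not_gt hc
    · exact (hright r hr2 (by grind) h).not_gt hr1
  rcases le_or_gt q (v⁻¹ k) with hb | hb
  · have huq : k ≤ u q := not_lt.1 fun h => by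
      have := (H.apply_lt_iff hx q).2 h
      order
    refine ⟨by order, hb, huq, ?_⟩
    by_contra hcon
    obtain ⟨c, hc, hmem⟩ := H.exists_mem_row (by order) hb (not_le.1 hcon)
    exact hnot c (by order) hmem
  · exfalso
    have hvq : k < v q := by
      have h5 : ¬ v q < k := fun h => by
        have := (H.apply_lt_iff hx q).2 ((H.apply_lt_iff H.oddDiagram_right q).1 h)
        order
      have h6 : v q ≠ k := fun h => hb.ne (by rw [Perm.inv_eq_iff_eq]; exact h.symm)
      order
    rcases H.exists_of_right_lt hb (by grind) hvq with ⟨c, hc, hmem⟩ | ⟨r, hr1, hr2, hr3, hr4⟩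
    · exact hnot c hc hmem
    · have h5 := hrow r (by order) (by grind) (hmid r (by order) hr2 (by grind))
      have := (H.apply_lt_iff H.oddDiagram_right r).2 ((H.apply_lt_iff hx r).1 h5)
      order

theorem apply_le_of_isBlock (hx : oddDiagram x = oddDiagram u) {i : Fin n}
    (hi : IsBlock u v k i) : x i ≤ u (v⁻¹ k) := by
  obtain ⟨hux, hxv⟩ := (H.oddDiagram_eq_iff x).1 hx
  clear hx
  induction hux generalizing i with
  | refl => exact hi.2.2.2
  | @tail y z huy hs ih =>
    obtain ⟨p, q, hpq, hlt, rfl⟩ := hs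
    have hyv := (bruhatLE_mul_swap hpq hlt).trans hxv
    have hy := (H.oddDiagram_eq_iff _).2 ⟨huy, hyv⟩
    have hz := (H.oddDiagram_eq_iff _).2 ⟨bruhatLE.trans huy (bruhatLE_mul_swap hpq hlt), hxv⟩
    rcases eq_or_ne i p with rfl | hip
    · simpa using ih (H.isBlock_of_step hy hz hpq hlt hi) hyv
    · rcases eq_or_ne i q with rfl | hiq
      · simpa using hlt.le.trans (ih hi hyv)
      · simpa [swap_apply_of_ne_of_ne hip hiq] using ih hi hyv

theorem lt_or_lt_of_not_isBlock (hx : oddDiagram x = oddDiagram u) {i : Fin n}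
    (h1 : u⁻¹ k ≤ i) (h2 : i ≤ v⁻¹ k) (hi : ¬ IsBlock u v k i) :
    x i < k ∨ u (v⁻¹ k) < x i := by
  rcases lt_or_ge (u i) k with h | h
  · exact Or.inl ((H.apply_lt_iff hx i).2 h)
  · right
    have h3 : u (v⁻¹ k) < u i := not_le.1 fun h' => hi ⟨h1, h2, h, h'⟩
    obtain ⟨c, hc, hmem⟩ := H.exists_mem_row h1 h2 h3
    rw [← hx] at hmem
    exact hc.trans hmem.1

theorem apply_eq_of_mem_interval {y w : Perm (Fin n)} {p : Fin n} (hux : bruhatLE u x)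
    (hxw : bruhatLE x w) (hwy : bruhatLE w y) (hyv : bruhatLE y v)
    (hxp : x p = k) (hyp : y p = k) : oddDiagram w = oddDiagram u ∧ w p = k := by
  have hmem : ∀ z, bruhatLE x z → bruhatLE z y → oddDiagram z = oddDiagram u :=
    fun z h h' => (H.oddDiagram_eq_iff z).2 ⟨hux.trans h, h'.trans hyv⟩
  have hw := hmem w hxw hwy
  have hx := hmem x Relation.ReflTransGen.refl (hxw.trans hwy)
  have hy := hmem y (hxw.trans hwy) Relation.ReflTransGen.refl
  have h2 := hxw.inv_apply_le fun i hi =>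
    (H.inv_apply_eq hx hi).trans (H.inv_apply_eq hw hi).symm
  have h3 := hwy.inv_apply_le fun i hi =>
    (H.inv_apply_eq hw hi).trans (H.inv_apply_eq hy hi).symm
  rw [Perm.inv_eq_iff_eq.2 hxp.symm] at h2
  rw [Perm.inv_eq_iff_eq.2 hyp.symm] at h3
  exact ⟨hw, (Perm.inv_eq_iff_eq.1 (le_antisymm h3 h2)).symm⟩

theorem le_apply_of_isBlock (hx : oddDiagram x = oddDiagram u) {i : Fin n}
    (hi : IsBlock u v k i) : k ≤ x i :=
  not_lt.1 fun h => hi.2.2.1.not_gt ((H.apply_lt_iff hx i).1 h)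

variable {p₀ p₁ : Fin n} (h₀ : IsBlock u v k p₀) (h₁ : IsBlock u v k p₁) (hlt : p₀ < p₁)
  (hcons : ∀ r, p₀ < r → r < p₁ → ¬ IsBlock u v k r)

include h₀ h₁ hcons

theorem lt_or_lt_of_between (hx : oddDiagram x = oddDiagram u) {r : Fin n} (h : p₀ < r)
    (h' : r < p₁) : x r < k ∨ (x p₀ < x r ∧ x p₁ < x r) := by
  have h2 := H.apply_le_of_isBlock hx h₀
  have h3 := H.apply_le_of_isBlock hx h₁
  exact (H.lt_or_lt_of_not_isBlock hx (h₀.1.trans h.le) (h'.le.trans h₁.2.1)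
    (hcons r h h')).imp_right fun h4 => ⟨h2.trans_lt h4, h3.trans_lt h4⟩

include hlt

theorem step_mul_swap_of_left {z : Perm (Fin n)} {p q : Fin n}
    (hz : oddDiagram z = oddDiagram u) (hy : oddDiagram (z * swap p q) = oddDiagram u)
    (hzk : z p₀ = k) (hyk : (z * swap p q) p₀ = k) (hpq : p < q) (hzpq : z p < z q) :
    bruhatLE (z * swap p₀ p₁) (z * swap p q * swap p₀ p₁) := by
  rw [mul_swap_mul_eq, swap_inv]
  refine bruhatLE_mul_swap ?_ (by simpa using hzpq)
  have hp : p ≠ p₀ := by rintro rfl; simp at hyk; order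
  have hq : q ≠ p₀ := by rintro rfl; simp at hyk; order
  rw [swap_apply_def, swap_apply_def, if_neg hp, if_neg hq]
  split_ifs with h5 h6 h6
  · order
  · order
  · subst h6
    by_contra h7
    rcases H.lt_or_lt_of_between h₀ h₁ hcons hz (r := p) (by order) hpq with h8 | h8
    · have := H.le_apply_of_isBlock hy h₁
      simp at this
      order
    · order
  · exact hpq

theorem step_mul_swap_of_right {z : Perm (Fin n)} {p q : Fin n}
    (hz : oddDiagram z = oddDiagram u) (hy : oddDiagram (z * swap p q) = oddDiagram u)
    (hzk : z p₁ = k) (hyk : (z * swap p q) p₁ = k) (hpq : p < q) (hzpq : z p < z q) :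
    bruhatLE (z * swap p₀ p₁) (z * swap p q * swap p₀ p₁) := by
  rw [mul_swap_mul_eq, swap_inv]
  refine bruhatLE_mul_swap ?_ (by simpa using hzpq)
  have hp : p ≠ p₁ := by rintro rfl; simp at hyk; order
  have hq : q ≠ p₁ := by rintro rfl; simp at hyk; order
  rw [swap_apply_def, swap_apply_def, if_neg hp, if_neg hq]
  split_ifs with h5 h6 h6
  · order
  · subst h5
    by_contra h7
    have h9 := H.le_apply_of_isBlock hz h₀
    rcases H.lt_or_lt_of_between h₀ h₁ hcons hy (r := q) hpq (by order) with h8 | h8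
    · simp at h8
      order
    · simp at h8
      order
  · order
  · exact hpq

theorem poincare_eq_poincare_mul_swap {U V : Perm (Fin n)} (hU : bruhatLE u U)
    (hV : bruhatLE V v) (hU' : bruhatLE u (U * swap p₀ p₁)) (hV' : bruhatLE (V * swap p₀ p₁) v)
    (hUk : U p₀ = k) (hVk : V p₀ = k) :
    poincare U V = poincare (U * swap p₀ p₁) (V * swap p₀ p₁) := by
  have hmem := fun z (hz : bruhatLE U z) (hz' : bruhatLE z V) =>
    H.apply_eq_of_mem_interval hU hz hz' hV hUk hVk
  have hmem' := fun z (hz : bruhatLE (U * swap p₀ p₁) z) (hz' : bruhatLE z (V * swap p₀ p₁)) =>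
    H.apply_eq_of_mem_interval hU' hz hz' hV' (p := p₁) (by simpa using hUk) (by simpa using hVk)
  have hmap : ∀ y z, bruhatLE U y → bruhatLE y z → bruhatLE z V →
      bruhatLE (y * swap p₀ p₁) (z * swap p₀ p₁) := fun y z hUy hyz hzV =>
    hyz.mul_right_of_forall fun a p q hya haz hpq hapq => by
      have hstep := bruhatLE_mul_swap hpq hapq
      obtain ⟨h1, h2⟩ := hmem a (hUy.trans hya) (hstep.trans (haz.trans hzV))
      obtain ⟨h3, h4⟩ := hmem _ (hUy.trans (hya.trans hstep)) (haz.trans hzV)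
      exact H.step_mul_swap_of_left h₀ h₁ hlt hcons h1 h3 h2 h4 hpq hapq
  have hmap' : ∀ y z, bruhatLE (U * swap p₀ p₁) y → bruhatLE y z →
      bruhatLE z (V * swap p₀ p₁) →
      bruhatLE (y * swap p₀ p₁) (z * swap p₀ p₁) := fun y z hUy hyz hzV =>
    hyz.mul_right_of_forall fun a p q hya haz hpq hapq => by
      have hstep := bruhatLE_mul_swap hpq hapq
      obtain ⟨h1, h2⟩ := hmem' a (hUy.trans hya) (hstep.trans (haz.trans hzV))
      obtain ⟨h3, h4⟩ := hmem' _ (hUy.trans (hya.trans hstep)) (haz.trans hzV)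
      exact H.step_mul_swap_of_right h₀ h₁ hlt hcons h1 h3 h2 h4 hpq hapq
  have hlen : ∀ z, bruhatLE U z → bruhatLE z V →
      invLength (z * swap p₀ p₁) = invLength z + 1 := fun z hUz hzV => by
    obtain ⟨h1, h2⟩ := hmem z hUz hzV
    have h3 := H.le_apply_of_isBlock h1 h₁
    have h4 : z p₀ ≠ z p₁ := fun h => hlt.ne (z.injective h)
    refine invLength_mul_swap_of_cover hlt (by order) fun r hr hr' hk => ?_
    rcases H.lt_or_lt_of_between h₀ h₁ hcons h1 hr hr' with h5 | h5 <;> order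
  refine Fintype.sum_equiv (Equiv.mulRight (swap p₀ p₁)) _ _ fun w => ?_
  have hiff : (bruhatLE U w ∧ bruhatLE w V) ↔ (bruhatLE (U * swap p₀ p₁) (w * swap p₀ p₁) ∧
      bruhatLE (w * swap p₀ p₁) (V * swap p₀ p₁)) := by
    constructor
    · rintro ⟨h1, h2⟩
      exact ⟨hmap U w Relation.ReflTransGen.refl h1 h2, hmap w V h1 h2 Relation.ReflTransGen.refl⟩
    · rintro ⟨h1, h2⟩
      simpa [mul_assoc] using And.intro (hmap' _ _ Relation.ReflTransGen.refl h1 h2)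
        (hmap' _ _ h1 h2 Relation.ReflTransGen.refl)
  by_cases h : bruhatLE U w ∧ bruhatLE w V
  · refine (if_pos h).trans (Eq.trans ?_ (if_pos (hiff.1 h)).symm)
    rw [Equiv.coe_mulRight, hlen w h.1 h.2,
      hlen U Relation.ReflTransGen.refl (h.1.trans h.2), Nat.add_sub_add_right]
  · exact (if_neg h).trans (if_neg (mt hiff.2 h)).symm

end IsClassInterval

end OddDiagram

/-- With the standing setup, the Poincaré polynomials of consecutive blocks agree:
`P_{uᵢ, vᵢ}(t) = P_{uᵢ₊₁, vᵢ₊₁}(t)`. -/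
theorem poincare_of_consecutive_blocks_equal {n : ℕ} (D : Set (Fin n × Fin n)) (u v : Equiv.Perm (Fin n))
    (hu : oddDiagram u = D) (hv : oddDiagram v = D) (hne : u ≠ v)
    (hint : ∀ w : Equiv.Perm (Fin n), oddDiagram w = D ↔ (bruhatLE u w ∧ bruhatLE w v))
    (k : Fin n) (hk : u⁻¹ k ≠ v⁻¹ k) (hkmin : ∀ i : Fin n, i < k → u⁻¹ i = v⁻¹ i)
    (m : ℕ) (hm : 0 < m) (aseq : Fin m → Fin n) (hmono : StrictMono aseq)
    (hrange : ∀ i : Fin n, (∃ j : Fin m, aseq j = i) ↔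
      (u⁻¹ k ≤ i ∧ i ≤ v⁻¹ k ∧ u (u⁻¹ k) ≤ u i ∧ u i ≤ u (v⁻¹ k)))
    (useq : Fin m → Equiv.Perm (Fin n))
    (huseq0 : useq ⟨0, hm⟩ = u)
    (huseqS : ∀ (i : ℕ) (h : i + 1 < m),
      useq ⟨i + 1, h⟩ = useq ⟨i, Nat.lt_of_succ_lt h⟩ *
        Equiv.swap (aseq ⟨i, Nat.lt_of_succ_lt h⟩) (aseq ⟨i + 1, h⟩))
    (vseq : Fin m → Equiv.Perm (Fin n))
    (hvseqm : vseq ⟨m - 1, Nat.sub_lt hm Nat.one_pos⟩ = v)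
    (hvseqS : ∀ (i : ℕ) (h : i + 1 < m),
      vseq ⟨i, Nat.lt_of_succ_lt h⟩ = vseq ⟨i + 1, h⟩ *
        Equiv.swap (aseq ⟨i, Nat.lt_of_succ_lt h⟩) (aseq ⟨i + 1, h⟩)) :
    ∀ (i : ℕ) (h : i + 1 < m),
      poincare (useq ⟨i, Nat.lt_of_succ_lt h⟩) (vseq ⟨i, Nat.lt_of_succ_lt h⟩) =
      poincare (useq ⟨i + 1, h⟩) (vseq ⟨i + 1, h⟩) := by
  subst hu
  have H : IsClassInterval u v k := ⟨hint, hk, hkmin⟩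
  have hblock : ∀ i, (∃ j, aseq j = i) ↔ IsBlock u v k i := fun i => by
    have huk : u (u⁻¹ k) = k := by simp
    rw [hrange, huk, IsBlock]
  have hb : ∀ j, IsBlock u v k (aseq j) := fun j => (hblock _).1 ⟨j, rfl⟩
  have h0 : u (aseq ⟨0, hm⟩) = k := by
    obtain ⟨j, hj⟩ := (hblock (u⁻¹ k)).2
      ⟨le_rfl, H.lt.le, by simp, by simpa using H.lt_apply_right.le⟩
    have h1 : aseq ⟨0, hm⟩ ≤ aseq j := hmono.monotone (Nat.zero_le _)
    rw [hj] at h1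
    simp [le_antisymm h1 (hb _).1]
  have hlast : v (aseq ⟨m - 1, Nat.sub_lt hm Nat.one_pos⟩) = k := by
    obtain ⟨j, hj⟩ := (hblock (v⁻¹ k)).2 ⟨H.lt.le, le_rfl, H.lt_apply_right.le, le_rfl⟩
    have h1 : aseq j ≤ aseq ⟨m - 1, Nat.sub_lt hm Nat.one_pos⟩ :=
      hmono.monotone (Nat.le_sub_one_of_lt j.2)
    rw [hj] at h1
    simp [le_antisymm (hb _).2.1 h1]
  have hukey : ∀ (i : ℕ) (h : i < m), useq ⟨i, h⟩ (aseq ⟨i, h⟩) = k ∧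
      (∀ j : Fin m, i < j → useq ⟨i, h⟩ (aseq j) = u (aseq j)) ∧ bruhatLE u (useq ⟨i, h⟩) := by
    intro i
    induction i with
    | zero =>
      intro h
      rw [huseq0]
      exact ⟨h0, fun _ _ => rfl, Relation.ReflTransGen.refl⟩
    | succ i ih =>
      intro h
      obtain ⟨h1, h2, h3⟩ := ih (Nat.lt_of_succ_lt h)
      have hlt : aseq ⟨i, Nat.lt_of_succ_lt h⟩ < aseq ⟨i + 1, h⟩ := hmono (Nat.lt_succ_self i)
      rw [huseqS i h]
      refine ⟨by simpa using h1, fun j hj => ?_, h3.trans (bruhatLE_mul_swap hlt ?_)⟩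
      · have h4 : aseq j ≠ aseq ⟨i, Nat.lt_of_succ_lt h⟩ := (hmono (by
          rw [Fin.lt_def]; dsimp; omega)).ne'
        have h5 : aseq j ≠ aseq ⟨i + 1, h⟩ := (hmono (by rw [Fin.lt_def]; exact hj)).ne'
        rw [Perm.mul_apply, swap_apply_of_ne_of_ne h4 h5, h2 j (by omega)]
      · refine lt_of_le_of_ne ?_ fun e => hlt.ne ((useq _).injective e)
        rw [h1, h2 _ (Nat.lt_succ_self i)]
        exact (hb _).2.2.1
  have hvkey : ∀ (d i : ℕ) (h : i < m), i + d + 1 = m → vseq ⟨i, h⟩ (aseq ⟨i, h⟩) = k ∧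
      (∀ j : Fin m, j < i → vseq ⟨i, h⟩ (aseq j) = v (aseq j)) ∧ bruhatLE (vseq ⟨i, h⟩) v := by
    intro d
    induction d with
    | zero =>
      intro i h hd
      obtain rfl : i = m - 1 := by omega
      rw [hvseqm]
      exact ⟨hlast, fun _ _ => rfl, Relation.ReflTransGen.refl⟩
    | succ d ih =>
      intro i h hd
      have h' : i + 1 < m := by omega
      obtain ⟨h1, h2, h3⟩ := ih (i + 1) h' (by omega)
      have hlt : aseq ⟨i, h⟩ < aseq ⟨i + 1, h'⟩ := hmono (Nat.lt_succ_self i)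
      have hS := hvseqS i h'
      have hS' : vseq ⟨i, h⟩ * swap (aseq ⟨i, h⟩) (aseq ⟨i + 1, h'⟩) = vseq ⟨i + 1, h'⟩ := by
        rw [hS, mul_assoc, swap_mul_self, mul_one]
      have h4 : vseq ⟨i, h⟩ (aseq ⟨i, h⟩) = k := by simpa [hS] using h1
      refine ⟨h4, fun j hj => ?_, ?_⟩
      · have h5 : aseq j ≠ aseq ⟨i, h⟩ := (hmono (by rw [Fin.lt_def]; exact hj)).ne
        have h6 : aseq j ≠ aseq ⟨i + 1, h'⟩ := (hmono (by rw [Fin.lt_def]; dsimp; omega)).ne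
        rw [hS, Perm.mul_apply, swap_apply_of_ne_of_ne h5 h6, h2 j (by omega)]
      · refine bruhatLE.trans ?_ h3
        rw [← hS']
        refine bruhatLE_mul_swap hlt (lt_of_le_of_ne ?_ fun e => hlt.ne ((vseq _).injective e))
        have h7 : vseq ⟨i, h⟩ (aseq ⟨i + 1, h'⟩) = v (aseq ⟨i, h⟩) := by
          rw [hS, Perm.mul_apply, swap_apply_right, h2 _ (Nat.lt_succ_self i)]
        rw [h4, h7]
        exact H.le_apply_of_isBlock hv (hb _)
  intro i h
  obtain ⟨hu1, -, hu2⟩ := hukey i (Nat.lt_of_succ_lt h)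
  obtain ⟨-, -, hu3⟩ := hukey (i + 1) h
  obtain ⟨hv1, -, hv2⟩ := hvkey (m - 1 - i) i (Nat.lt_of_succ_lt h) (by omega)
  obtain ⟨-, -, hv3⟩ := hvkey (m - 1 - (i + 1)) (i + 1) h (by omega)
  have hV : vseq ⟨i + 1, h⟩ = vseq ⟨i, Nat.lt_of_succ_lt h⟩ *
      swap (aseq ⟨i, Nat.lt_of_succ_lt h⟩) (aseq ⟨i + 1, h⟩) := by
    rw [hvseqS i h, mul_assoc, swap_mul_self, mul_one]
  rw [hV] at hv3 ⊢
  rw [huseqS i h] at hu3 ⊢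
  refine H.poincare_eq_poincare_mul_swap (hb _) (hb _) (hmono (Nat.lt_succ_self i))
    (fun r hr hr' hblk => ?_) hu2 hv2 hu3 hv3 hu1 hv1
  obtain ⟨j, rfl⟩ := (hblock r).2 hblk
  rw [hmono.lt_iff_lt, Fin.lt_def] at hr hr'
  dsimp at hr hr'
  omega
end

section
/- The Poincaré polynomial of any odd diagram class can be expressed as a product of factors of the form 1 + t + ... + t^m: if Perm(D) is an odd diagram class, equal to the Bruhat interval [u,v], then there exist positive integers m_1, ..., m_r such that P_{u,v}(t) = ∏_{j=1}^r (1 + t + t^2 + ... + t^{m_j}). -/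
open Equiv Finset Polynomial

/-- The box relation of the coloured diagram of `w`: rows are positions, columns are values. -/
def colorBox {n : ℕ} (c : Fin n → ℕ) (w : Equiv.Perm (Fin n)) (i j : Fin n) : Prop :=
  j < w i ∧ i < w⁻¹ j ∧ c i ≠ c (w⁻¹ j)

open Classical in
/-- The length generating function of the permutations with coloured diagram `D`. -/
noncomputable def classGF {n : ℕ} (c : Fin n → ℕ) (D : Fin n → Fin n → Prop) : Polynomial ℤ :=
  ∑ w : Equiv.Perm (Fin n), if colorBox c w = D then (X : Polynomial ℤ) ^ invLength w else 0

/-- Insert the smallest value at position `p`. -/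
def insertMin {n : ℕ} (p : Fin (n + 1)) (w : Equiv.Perm (Fin n)) : Equiv.Perm (Fin (n + 1)) :=
  (finSuccEquiv' p).trans ((Equiv.optionCongr w).trans (finSuccEquiv n).symm)

@[simp]
theorem insertMin_self {n : ℕ} (p : Fin (n + 1)) (w : Equiv.Perm (Fin n)) :
    insertMin p w p = 0 := by
  simp [insertMin]

@[simp]
theorem insertMin_succAbove {n : ℕ} (p : Fin (n + 1)) (w : Equiv.Perm (Fin n)) (i : Fin n) :
    insertMin p w (p.succAbove i) = (w i).succ := by
  simp [insertMin]

@[simp]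
theorem insertMin_inv_zero {n : ℕ} (p : Fin (n + 1)) (w : Equiv.Perm (Fin n)) :
    (insertMin p w)⁻¹ 0 = p := by
  rw [Equiv.Perm.inv_eq_iff_eq, insertMin_self]

@[simp]
theorem insertMin_inv_succ {n : ℕ} (p : Fin (n + 1)) (w : Equiv.Perm (Fin n)) (j : Fin n) :
    (insertMin p w)⁻¹ j.succ = p.succAbove (w⁻¹ j) := by
  rw [Equiv.Perm.inv_eq_iff_eq, insertMin_succAbove]
  simp

theorem insertMin_bijective (n : ℕ) :
    Function.Bijective (fun q : Fin (n + 1) × Equiv.Perm (Fin n) => insertMin q.1 q.2) := by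
  rw [Fintype.bijective_iff_injective_and_card]
  constructor
  · rintro ⟨p, w⟩ ⟨q, w'⟩ h
    simp only at h
    have hpq : p = q := by
      rw [← insertMin_inv_zero p w, h, insertMin_inv_zero]
    subst hpq
    have hw : w = w' := by
      ext1 i
      have := congrArg (fun f : Equiv.Perm (Fin (n + 1)) => f (p.succAbove i)) h
      simpa using this
    rw [hw]
  · simp [Fintype.card_perm, Nat.factorial_succ]

theorem sum_perm_succ {n : ℕ} {M : Type*} [AddCommMonoid M]
    (f : Equiv.Perm (Fin (n + 1)) → M) :
    ∑ w, f w = ∑ p : Fin (n + 1), ∑ w : Equiv.Perm (Fin n), f (insertMin p w) := by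
  rw [← Fintype.sum_prod_type']
  exact ((insertMin_bijective n).sum_comp f).symm

theorem invLength_insertMin {n : ℕ} (p : Fin (n + 1)) (w : Equiv.Perm (Fin n)) :
    invLength (insertMin p w) = p + invLength w := by
  have hp : ∑ i : Fin n, (if p.succAbove i < p then 1 else 0) = (p : ℕ) := by
    have h := Fin.sum_univ_succAbove (fun i => if i < p then 1 else 0) p
    simp only [lt_irrefl, if_false, zero_add] at h
    rw [← h, ← Finset.card_filter]
    have : Finset.univ.filter (fun i => i < p) = Finset.Iio p := by ext; simp
    rw [this, Fin.card_Iio]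
  unfold invLength
  rw [Finset.card_filter, Finset.card_filter, Fintype.sum_prod_type, Fintype.sum_prod_type,
    Fin.sum_univ_succAbove _ p]
  simp only [Fin.sum_univ_succAbove _ p, insertMin_self, insertMin_succAbove,
    Fin.not_lt_zero, and_false, if_false, Fin.succ_pos, and_true,
    Fin.succ_lt_succ_iff, Fin.succAbove_lt_succAbove_iff, Finset.sum_const_zero, zero_add,
    Finset.sum_add_distrib, hp]

/-- Positions where the smallest value may sit in a permutation with coloured diagram `D`. -/
def MinSite {n : ℕ} (c : Fin (n + 1) → ℕ) (D : Fin (n + 1) → Fin (n + 1) → Prop)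
    (p : Fin (n + 1)) : Prop :=
  (∀ j, ¬ D p j) ∧ ∀ i, D i 0 ↔ i < p ∧ c i ≠ c p

theorem colorBox_insertMin_iff {n : ℕ} (c : Fin (n + 1) → ℕ) (p : Fin (n + 1))
    (w : Equiv.Perm (Fin n)) (D : Fin (n + 1) → Fin (n + 1) → Prop) :
    colorBox c (insertMin p w) = D ↔
      MinSite c D p ∧
      colorBox (c ∘ p.succAbove) w = fun i j => D (p.succAbove i) j.succ := by
  constructor
  · rintro rfl
    refine ⟨⟨fun j => by simp [colorBox], fun i => ?_⟩, ?_⟩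
    · refine Fin.succAboveCases p ?_ (fun i => ?_) i <;> simp [colorBox]
    · funext i j
      simp [colorBox]
  · rintro ⟨⟨h1, h2⟩, h3⟩
    funext i j
    refine Fin.succAboveCases p ?_ (fun i => ?_) i
    · simpa [colorBox] using h1 j
    · refine Fin.cases ?_ (fun j => ?_) j
      · simp [colorBox, h2]
      · rw [← congrFun (congrFun h3 i) j]
        simp [colorBox]

open Classical in
theorem classGF_succ {n : ℕ} (c : Fin (n + 1) → ℕ) (D : Fin (n + 1) → Fin (n + 1) → Prop) :
    classGF c D = ∑ p ∈ Finset.univ.filter (MinSite c D), (X : Polynomial ℤ) ^ (p : ℕ) *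
      classGF (c ∘ p.succAbove) (fun i j => D (p.succAbove i) j.succ) := by
  unfold classGF
  rw [sum_perm_succ, Finset.sum_filter]
  refine Finset.sum_congr rfl fun p _ => ?_
  simp only [colorBox_insertMin_iff]
  by_cases hp : MinSite c D p
  · rw [if_pos hp, Finset.mul_sum]
    refine Finset.sum_congr rfl fun w _ => ?_
    simp [hp, invLength_insertMin, pow_add]
  · rw [if_neg hp]
    simp [hp]

theorem minSite_color_eq {n : ℕ} {c : Fin (n + 1) → ℕ} {D : Fin (n + 1) → Fin (n + 1) → Prop}
    {p q i : Fin (n + 1)} (hp : MinSite c D p) (hq : MinSite c D q) (hpi : p ≤ i) (hiq : i ≤ q) :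
    c i = c p := by
  have hpq : c p = c q := by
    by_contra h
    rcases (hpi.trans hiq).lt_or_eq with hlt | heq
    · exact hp.1 0 ((hq.2 p).2 ⟨hlt, h⟩)
    · exact h (by rw [heq])
  by_contra h
  rcases hiq.lt_or_eq with hlt | heq
  · exact absurd ((hp.2 i).1 ((hq.2 i).2 ⟨hlt, hpq ▸ h⟩)).1 (not_lt.2 hpi)
  · exact h (by rw [heq, hpq])

/-- Within each monochromatic run, the empty rows precede the others. -/
def EmptyRowsFirst {n : ℕ} (c : Fin n → ℕ) (D : Fin n → Fin n → Prop) : Prop :=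
  ∀ i j : Fin n, (i : ℕ) + 1 = j → c i = c j → (∀ k, ¬ D j k) → ∀ k, ¬ D i k

theorem minSite_row_empty {n : ℕ} {c : Fin (n + 1) → ℕ} {D : Fin (n + 1) → Fin (n + 1) → Prop}
    (hD : EmptyRowsFirst c D) {p q : Fin (n + 1)} (hp : MinSite c D p) (hq : MinSite c D q) :
    ∀ (d : ℕ) (i : Fin (n + 1)), p ≤ i → (i : ℕ) + d = q → ∀ k, ¬ D i k := by
  intro d
  induction d with
  | zero =>
    intro i _ hi
    have : i = q := Fin.ext (by simpa using hi)
    exact this ▸ hq.1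
  | succ d ih =>
    intro i hpi hi
    have hlt : (i : ℕ) + 1 < n + 1 := by have := q.2; omega
    have hle : p ≤ ⟨(i : ℕ) + 1, hlt⟩ := by
      rw [Fin.le_def] at *; simp only; omega
    refine hD i ⟨i + 1, hlt⟩ rfl ?_ (ih _ hle (by simp only; omega))
    rw [minSite_color_eq hp hq hpi (by rw [Fin.le_def]; omega),
      minSite_color_eq hp hq hle (by rw [Fin.le_def]; simp only; omega)]

theorem minSite_between {n : ℕ} {c : Fin (n + 1) → ℕ} {D : Fin (n + 1) → Fin (n + 1) → Prop}
    (hD : EmptyRowsFirst c D) {p q i : Fin (n + 1)} (hp : MinSite c D p) (hq : MinSite c D q)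
    (hpi : p ≤ i) (hiq : i ≤ q) : MinSite c D i := by
  refine ⟨minSite_row_empty hD hp hq (q - i) i hpi (by rw [Fin.le_def] at hiq; omega),
    fun k => ?_⟩
  rw [hp.2, minSite_color_eq hp hq hpi hiq]
  constructor
  · rintro ⟨h1, h2⟩
    exact ⟨h1.trans_le hpi, h2⟩
  · rintro ⟨h1, h2⟩
    refine ⟨?_, h2⟩
    by_contra h
    exact h2 (minSite_color_eq hp hq (not_lt.1 h) (h1.le.trans hiq))

theorem succAbove_eq_or_between {n : ℕ} {p q : Fin (n + 1)} (hpq : p ≤ q) (i : Fin n) :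
    p.succAbove i = q.succAbove i ∨
      ((p ≤ p.succAbove i ∧ p.succAbove i ≤ q) ∧ (p ≤ q.succAbove i ∧ q.succAbove i ≤ q)) := by
  simp only [Fin.succAbove, Fin.lt_def, Fin.le_def] at *
  split_ifs <;> simp at * <;> omega

theorem minSite_reduction_eq {n : ℕ} {c : Fin (n + 1) → ℕ}
    {D : Fin (n + 1) → Fin (n + 1) → Prop} (hD : EmptyRowsFirst c D) {p q : Fin (n + 1)}
    (hp : MinSite c D p) (hq : MinSite c D q) (hpq : p ≤ q) :
    classGF (c ∘ p.succAbove) (fun i j => D (p.succAbove i) j.succ) =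
      classGF (c ∘ q.succAbove) (fun i j => D (q.succAbove i) j.succ) := by
  congr 1
  · funext i
    rcases succAbove_eq_or_between hpq i with h | ⟨⟨h1, h2⟩, h3, h4⟩
    · simp [h]
    · simp only [Function.comp]
      rw [minSite_color_eq hp hq h1 h2, minSite_color_eq hp hq h3 h4]
  · funext i j
    rcases succAbove_eq_or_between hpq i with h | ⟨⟨h1, h2⟩, h3, h4⟩
    · simp [h]
    · simp [(minSite_between hD hp hq h1 h2).1, (minSite_between hD hp hq h3 h4).1]

/-- A polynomial that is zero, or a monomial times a product of factors `1 + t + ⋯ + t ^ m`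
with `m` positive. -/
def IsShiftedQProduct (f : Polynomial ℤ) : Prop :=
  f = 0 ∨ ∃ (a r : ℕ) (ms : Fin r → ℕ), (∀ j, 0 < ms j) ∧
    f = X ^ a * ∏ j : Fin r, ∑ i ∈ Finset.range (ms j + 1), (X : Polynomial ℤ) ^ i

theorem IsShiftedQProduct.X_pow_mul {f : Polynomial ℤ} (hf : IsShiftedQProduct f) (b : ℕ) :
    IsShiftedQProduct (X ^ b * f) := by
  rcases hf with rfl | ⟨a, r, ms, hms, rfl⟩
  · exact Or.inl (mul_zero _)
  · exact Or.inr ⟨b + a, r, ms, hms, by rw [pow_add, mul_assoc]⟩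

theorem IsShiftedQProduct.geom_mul {f : Polynomial ℤ} (hf : IsShiftedQProduct f) (m : ℕ) :
    IsShiftedQProduct ((∑ i ∈ Finset.range (m + 1), (X : Polynomial ℤ) ^ i) * f) := by
  rcases m.eq_zero_or_pos with rfl | hm
  · simpa using hf
  rcases hf with rfl | ⟨a, r, ms, hms, rfl⟩
  · exact Or.inl (mul_zero _)
  · refine Or.inr ⟨a, r + 1, Fin.cons m ms, fun j => ?_, ?_⟩
    · refine Fin.cases ?_ (fun j => ?_) j
      · simpa using hm
      · simpa using hms j
    · rw [Fin.prod_univ_succ]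
      simp only [Fin.cons_zero, Fin.cons_succ]
      ring

theorem sum_X_pow_Icc {n : ℕ} {a b : Fin n} (hab : a ≤ b) :
    ∑ p ∈ Finset.Icc a b, (X : Polynomial ℤ) ^ (p : ℕ) =
      X ^ (a : ℕ) * ∑ i ∈ Finset.range ((b : ℕ) - a + 1), (X : Polynomial ℤ) ^ i := by
  rw [Fin.le_def] at hab
  have h : ∑ p ∈ Finset.Icc a b, (X : Polynomial ℤ) ^ (p : ℕ) =
      ∑ p ∈ Finset.Icc (a : ℕ) b, (X : Polynomial ℤ) ^ p := by
    rw [← Fin.map_valEmbedding_Icc, Finset.sum_map]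
    rfl
  rw [h, ← Finset.Ico_add_one_right_eq_Icc, Finset.sum_Ico_eq_sum_range, Finset.mul_sum]
  simp only [pow_add]
  rw [show (b : ℕ) + 1 - a = b - a + 1 by omega]

theorem classGF_isShiftedQProduct_of_emptyRowsFirst {n : ℕ} {c : Fin (n + 1) → ℕ}
    {D : Fin (n + 1) → Fin (n + 1) → Prop} (hD : EmptyRowsFirst c D)
    (ih : ∀ (c' : Fin n → ℕ) (D' : Fin n → Fin n → Prop), IsShiftedQProduct (classGF c' D')) :
    IsShiftedQProduct (classGF c D) := by
  classical
  rw [classGF_succ]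
  rcases (Finset.univ.filter (MinSite c D)).eq_empty_or_nonempty with hS | hS
  · left
    convert Finset.sum_empty
  obtain ⟨a, ha⟩ : ∃ a, a = (Finset.univ.filter (MinSite c D)).min' hS := ⟨_, rfl⟩
  obtain ⟨b, hb⟩ : ∃ b, b = (Finset.univ.filter (MinSite c D)).max' hS := ⟨_, rfl⟩
  have hsa : MinSite c D a := by
    have := Finset.min'_mem _ hS
    rw [← ha] at this
    simpa using this
  have hsb : MinSite c D b := by
    have := Finset.max'_mem _ hS
    rw [← hb] at this
    simpa using this
  have hab : a ≤ b := by
    rw [hb]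
    exact Finset.le_max' _ _ (by simpa using hsa)
  have hIcc : Finset.univ.filter (MinSite c D) = Finset.Icc a b := by
    ext p
    rw [Finset.mem_Icc]
    constructor
    · intro hp
      rw [ha, hb]
      exact ⟨Finset.min'_le _ _ hp, Finset.le_max' _ _ hp⟩
    · rintro ⟨h1, h2⟩
      simpa using minSite_between hD hsa hsb h1 h2
  have hsum : ∀ p ∈ Finset.Icc a b, (X : Polynomial ℤ) ^ (p : ℕ) *
      classGF (c ∘ p.succAbove) (fun i j => D (p.succAbove i) j.succ) =
      X ^ (p : ℕ) * classGF (c ∘ a.succAbove) (fun i j => D (a.succAbove i) j.succ) := by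
    intro p hp
    have hp' := hp
    rw [Finset.mem_Icc] at hp'
    rw [← hIcc] at hp
    rw [minSite_reduction_eq hD hsa (by simpa using hp) hp'.1]
  have key := Finset.sum_congr rfl hsum
  rw [← Finset.sum_mul, sum_X_pow_Icc hab, mul_assoc] at key
  have hgood := ((ih (c ∘ a.succAbove) (fun i j => D (a.succAbove i) j.succ)).geom_mul
    ((b : ℕ) - a)).X_pow_mul (a : ℕ)
  rw [← key] at hgood
  convert hgood using 2

theorem swap_lt_swap_iff_of_adjacent {n : ℕ} {i j : Fin n} (hij : (i : ℕ) + 1 = j) {a b : Fin n}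
    (hab : ¬ (a = i ∧ b = j)) (hba : ¬ (a = j ∧ b = i)) :
    Equiv.swap i j a < Equiv.swap i j b ↔ a < b := by
  simp only [Equiv.swap_apply_def, Fin.ext_iff, Fin.lt_def] at *
  split_ifs <;> omega

theorem colorBox_mul_swap {n : ℕ} {c : Fin n → ℕ} {i j : Fin n} (hij : (i : ℕ) + 1 = j)
    (hc : c i = c j) (w : Equiv.Perm (Fin n)) (k l : Fin n) :
    colorBox c (w * Equiv.swap i j) k l ↔ colorBox c w (Equiv.swap i j k) l := by
  have hcs : ∀ a, c (Equiv.swap i j a) = c a := by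
    intro a
    rw [Equiv.swap_apply_def]
    split_ifs with h1 h2 <;> simp [*]
  simp only [colorBox, mul_inv_rev, Equiv.swap_inv, Equiv.Perm.mul_apply, hcs]
  refine and_congr_right fun _ => and_congr_left fun hne => ?_
  have h := swap_lt_swap_iff_of_adjacent hij (a := Equiv.swap i j k) (b := w⁻¹ l)
    (fun h => hne (by rw [← hcs k, h.1, h.2, hc])) (fun h => hne (by rw [← hcs k, h.1, h.2, hc]))
  rwa [Equiv.swap_apply_self] at h

theorem invLength_eq_mul_swap_add_one {n : ℕ} {i j : Fin n} (hij : (i : ℕ) + 1 = j)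
    {w : Equiv.Perm (Fin n)} (hw : w j < w i) :
    invLength w = invLength (w * Equiv.swap i j) + 1 := by
  have hlt : i < j := by rw [Fin.lt_def]; omega
  unfold invLength
  have hset : Finset.univ.filter (fun p : Fin n × Fin n => p.1 < p.2 ∧ w p.2 < w p.1) =
      insert (i, j) ((Finset.univ.filter (fun p : Fin n × Fin n => p.1 < p.2 ∧
        (w * Equiv.swap i j) p.2 < (w * Equiv.swap i j) p.1)).map
        ((Equiv.swap i j).prodCongr (Equiv.swap i j)).toEmbedding) := by
    ext ⟨a, b⟩
    rw [Finset.mem_insert, Finset.mem_map_equiv, Finset.mem_filter, Finset.mem_filter]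
    simp only [Finset.mem_univ, true_and, Equiv.prodCongr_symm, Equiv.symm_swap, Equiv.prodCongr_apply, Prod.map,
      Equiv.Perm.mul_apply, Equiv.swap_apply_self, Prod.mk.injEq]
    by_cases h1 : a = i ∧ b = j
    · obtain ⟨rfl, rfl⟩ := h1
      simp [hlt, hw]
    by_cases h2 : a = j ∧ b = i
    · obtain ⟨rfl, rfl⟩ := h2
      simp [hw.le, hlt.ne']
    · simp [h1, swap_lt_swap_iff_of_adjacent hij h1 h2]
  rw [hset, Finset.card_insert_of_notMem, Finset.card_map]
  rw [Finset.mem_map_equiv, Finset.mem_filter]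
  simp [hlt.le]

theorem classGF_eq_X_mul_swap {n : ℕ} {c : Fin n → ℕ} {D : Fin n → Fin n → Prop} {i j : Fin n}
    (hij : (i : ℕ) + 1 = j) (hc : c i = c j) (hj : ∀ k, ¬ D j k) (hi : ∃ k, D i k) :
    classGF c D = X * classGF c (fun k => D (Equiv.swap i j k)) := by
  classical
  unfold classGF
  rw [← Equiv.sum_comp (Equiv.mulRight (Equiv.swap i j))
    (fun w => if colorBox c w = fun k => D (Equiv.swap i j k) then
      (X : Polynomial ℤ) ^ invLength w else 0), Finset.mul_sum]
  refine Finset.sum_congr rfl fun w _ => ?_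
  have hiff : (colorBox c (w * Equiv.swap i j) = fun k => D (Equiv.swap i j k)) ↔
      colorBox c w = D := by
    constructor
    · intro h
      funext k l
      have h1 := congrFun (congrFun h (Equiv.swap i j k)) l
      rw [colorBox_mul_swap hij hc, Equiv.swap_apply_self] at h1
      exact h1
    · rintro rfl
      funext k l
      exact propext (colorBox_mul_swap hij hc w k l)
  simp only [Equiv.coe_mulRight, hiff]
  split_ifs with h
  · subst h
    have hw : w j < w i := by
      obtain ⟨k, h1, h2, h3⟩ := hi
      by_contra hle
      refine hj k ⟨h1.trans_le (not_lt.1 hle), ?_, hc ▸ h3⟩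
      have hne : w⁻¹ k ≠ j := fun h => h3 (by rw [h, hc])
      rw [Fin.lt_def] at *
      have := Fin.val_ne_of_ne hne
      omega
    rw [invLength_eq_mul_swap_add_one hij hw, pow_succ']
  · simp

open Classical in
/-- The sum of the positions of the empty rows of `D`. -/
noncomputable def emptyRowSum {n : ℕ} (D : Fin n → Fin n → Prop) : ℕ :=
  ∑ i : Fin n, if ∀ k, ¬ D i k then (i : ℕ) else 0

theorem emptyRowSum_swap_lt {n : ℕ} {D : Fin n → Fin n → Prop} {i j : Fin n}
    (hij : (i : ℕ) + 1 = j) (hj : ∀ k, ¬ D j k) (hi : ∃ k, D i k) :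
    emptyRowSum (fun k => D (Equiv.swap i j k)) < emptyRowSum D := by
  classical
  unfold emptyRowSum
  rw [← Equiv.sum_comp (Equiv.swap i j)
    (fun a => if ∀ k, ¬ D (Equiv.swap i j a) k then (a : ℕ) else 0)]
  simp only [Equiv.swap_apply_self]
  have hi' : ¬ ∀ k, ¬ D i k := by simpa using hi
  refine Finset.sum_lt_sum (fun a _ => ?_) ⟨j, Finset.mem_univ _, ?_⟩
  · by_cases hai : a = i
    · subst hai
      simp [hi']
    · by_cases haj : a = j
      · subst haj
        simp only [Equiv.swap_apply_right]
        split_ifs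
        omega
      · rw [Equiv.swap_apply_of_ne_of_ne hai haj]
  · rw [if_pos hj, if_pos hj, Equiv.swap_apply_right]
    omega

theorem classGF_isShiftedQProduct :
    ∀ (n : ℕ) (c : Fin n → ℕ) (D : Fin n → Fin n → Prop), IsShiftedQProduct (classGF c D) := by
  intro n
  induction n with
  | zero =>
    intro c D
    refine Or.inr ⟨0, 0, Fin.elim0, fun j => j.elim0, ?_⟩
    simp [classGF, invLength, Subsingleton.elim _ D]
  | succ n ih =>
    intro c D
    induction hs : emptyRowSum D using Nat.strong_induction_on generalizing D with
    | _ s ihs =>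
      subst hs
      by_cases hD : EmptyRowsFirst c D
      · exact classGF_isShiftedQProduct_of_emptyRowsFirst hD ih
      · unfold EmptyRowsFirst at hD
        push Not at hD
        obtain ⟨i, j, hij, hc, hj, hi⟩ := hD
        rw [classGF_eq_X_mul_swap hij hc hj hi, ← pow_one (X : Polynomial ℤ)]
        exact (ihs _ (emptyRowSum_swap_lt hij hj hi) _ rfl).X_pow_mul 1

theorem invLength_le_mul_swap {n : ℕ} {i j : Fin n} (hij : i < j) {x : Equiv.Perm (Fin n)}
    (hx : x i < x j) : invLength x ≤ invLength (x * Equiv.swap i j) := by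
  have hinv : ∀ a, Equiv.swap i j (Equiv.swap i j a) = a := Equiv.swap_apply_self i j
  refine Finset.card_le_card_of_injOn (fun p => if Equiv.swap i j p.1 < Equiv.swap i j p.2 then
    (Equiv.swap i j p.1, Equiv.swap i j p.2) else p) ?_ ?_
  · rintro ⟨a, b⟩ hab
    simp only [Finset.coe_filter, Finset.mem_univ, true_and, Set.mem_ofPred_eq] at hab ⊢
    obtain ⟨h1, h2⟩ := hab
    split_ifs with h
    · exact ⟨h, by simpa using h2⟩
    · refine ⟨h1, ?_⟩
      simp only [Equiv.Perm.mul_apply]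
      simp only [Equiv.swap_apply_def] at h ⊢
      split_ifs at h ⊢ <;> subst_vars <;> order
  · rintro ⟨a, b⟩ hab ⟨a', b'⟩ hab' h
    simp only [Finset.coe_filter, Finset.mem_univ, true_and, Set.mem_ofPred_eq] at hab hab' h
    split_ifs at h with h1 h2 h2
    · simpa using h
    · obtain ⟨rfl, rfl⟩ := Prod.mk.inj h
      simp only [hinv] at h2
      exact absurd hab.1 h2
    · obtain ⟨rfl, rfl⟩ := Prod.mk.inj h
      simp only [hinv] at h1
      exact absurd hab'.1 h1
    · exact h

theorem bruhatLE.invLength_le {n : ℕ} {u w : Equiv.Perm (Fin n)} (h : bruhatLE u w) :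
    invLength u ≤ invLength w := by
  unfold bruhatLE at h
  induction h with
  | refl => exact le_rfl
  | tail _ hstep ih =>
    obtain ⟨i, j, hij, hlt, rfl⟩ := hstep
    exact ih.trans (invLength_le_mul_swap hij hlt)

theorem oddDiagram_eq_iff {n : ℕ} (w : Equiv.Perm (Fin n)) (D : Set (Fin n × Fin n)) :
    oddDiagram w = D ↔ colorBox (fun i => (i : ℕ) % 2) w = fun i j => (i, j) ∈ D := by
  constructor
  · rintro rfl
    rfl
  · intro h
    ext ⟨i, j⟩
    rw [← congrFun (congrFun h i) j]
    rfl

theorem coeff_zero_poincare_pos {n : ℕ} {u v : Equiv.Perm (Fin n)} (huv : bruhatLE u v) :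
    0 < (poincare u v).coeff 0 := by
  classical
  unfold poincare
  rw [Polynomial.finsetSum_coeff]
  refine Finset.sum_pos' (fun w _ => ?_) ⟨u, Finset.mem_univ _, ?_⟩
  · split_ifs
    · rw [Polynomial.coeff_X_pow]
      split_ifs <;> simp
    · simp
  · rw [if_pos ⟨Relation.ReflTransGen.refl, huv⟩]
    simp

theorem X_pow_mul_poincare {n : ℕ} (D : Set (Fin n × Fin n)) (u v : Equiv.Perm (Fin n))
    (hint : ∀ w : Equiv.Perm (Fin n), oddDiagram w = D ↔ (bruhatLE u w ∧ bruhatLE w v)) :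
    X ^ invLength u * poincare u v =
      classGF (fun i : Fin n => (i : ℕ) % 2) (fun i j => (i, j) ∈ D) := by
  unfold poincare classGF
  rw [Finset.mul_sum]
  refine Finset.sum_congr rfl fun w _ => ?_
  have hw := (oddDiagram_eq_iff w D).symm.trans (hint w)
  by_cases h : bruhatLE u w ∧ bruhatLE w v
  · rw [if_pos h, if_pos (hw.2 h), ← pow_add, Nat.add_sub_cancel' h.1.invLength_le]
  · rw [if_neg h, if_neg (mt hw.1 h), mul_zero]

/-- The Poincaré polynomial of any odd diagram class factors into polynomials of
the form `1 + t + ⋯ + t^m`. -/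
theorem poincare_of_odd_diagram_class_factors {n : ℕ} (D : Set (Fin n × Fin n))
    (u v : Equiv.Perm (Fin n)) (hu : oddDiagram u = D) (hv : oddDiagram v = D)
    (hint : ∀ w : Equiv.Perm (Fin n), oddDiagram w = D ↔ (bruhatLE u w ∧ bruhatLE w v)) :
    ∃ (r : ℕ) (ms : Fin r → ℕ), (∀ j : Fin r, 0 < ms j) ∧
      poincare u v =
        ∏ j : Fin r, ∑ i ∈ Finset.range (ms j + 1), (X : Polynomial ℤ) ^ i := by
  have hP := coeff_zero_poincare_pos ((hint u).1 hu).2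
  have hX := X_pow_mul_poincare D u v hint
  rcases classGF_isShiftedQProduct n (fun i : Fin n => (i : ℕ) % 2) (fun i j => (i, j) ∈ D) with
    h0 | ⟨a, r, ms, hms, hprod⟩
  · rw [h0, mul_eq_zero] at hX
    rcases hX with hX | hX
    · exact absurd hX (pow_ne_zero _ X_ne_zero)
    · simp [hX] at hP
  refine ⟨r, ms, hms, ?_⟩
  rw [hprod] at hX
  have hQ : (∏ j : Fin r, ∑ i ∈ Finset.range (ms j + 1), (X : Polynomial ℤ) ^ i).coeff 0 = 1 := by
    rw [Polynomial.coeff_zero_prod]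
    refine Finset.prod_eq_one fun j _ => ?_
    rw [Finset.sum_range_succ']
    simp [Polynomial.finsetSum_coeff, Polynomial.coeff_X_pow]
  have ha : a = invLength u := by
    rcases lt_trichotomy a (invLength u) with h | h | h
    · have := congrArg (fun f : Polynomial ℤ => f.coeff a) hX
      simp [Polynomial.coeff_X_pow_mul', hQ, h.not_ge] at this
    · exact h
    · have := congrArg (fun f : Polynomial ℤ => f.coeff (invLength u)) hX
      simp only [Polynomial.coeff_X_pow_mul', le_refl, if_true, Nat.sub_self, h.not_ge,
        if_false] at this
      exact absurd this hP.ne'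
  rw [ha] at hX
  exact mul_left_cancel₀ (pow_ne_zero _ X_ne_zero) hX
end
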